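/- arXiv:math/9910108 — 3 statements merged into one kernel-verified Lean document; each statement's English description precedes it below -/
import Mathlib

section
/- Let V₁, …, Vₙ be finitely many closed subsets of ℝ², each homeomorphic to the closed disk, with ⋃ᵢ int Vᵢ connected, and let W be the unbounded component of ℝ² \ ⋃ᵢ Vᵢ. Then every point of ∂W is accessible from W. -/
open Metric Set

/-- The plane `ℝ²`. -/
abbrev Plane := EuclideanSpace ℝ (Fin 2)

/-- A point `x` is accessible from a set `E` if there is a continuous injective map
`φ : [0,1] → ℝ²` with `φ 1 = x` and `φ([0,1)) ⊆ E`. -/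
def Accessible (E : Set Plane) (x : Plane) : Prop :=
  ∃ φ : ℝ → Plane, ContinuousOn φ (Icc 0 1) ∧ InjOn φ (Icc 0 1) ∧
    φ 1 = x ∧ φ '' Ico 0 1 ⊆ E

open Filter Topology in
/-- If a nonvanishing jointly continuous family of functions on a compact space is parametrized by a
preconnected space, the ratio of any two members has a continuous logarithm. -/
theorem exists_log_div {α β : Type*} [TopologicalSpace α] [PreconnectedSpace α]
    [TopologicalSpace β] [CompactSpace β] {F : α → β → ℂ} (hF : Continuous (Function.uncurry F))
    (h0 : ∀ a z, F a z ≠ 0) (a b : α) :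
    ∃ g : β → ℂ, Continuous g ∧ ∀ z, Complex.exp (g z) = F b z / F a z := by
  have hFa : ∀ a, Continuous (F a) := fun a => hF.comp (Continuous.prodMk_right a)
  let P : α → α → Prop := fun a b =>
    ∃ g : β → ℂ, Continuous g ∧ ∀ z, Complex.exp (g z) = F b z / F a z
  have hsymm : Std.Symm P := by
    refine ⟨?_⟩
    rintro a b ⟨g, hg, hgz⟩
    refine ⟨fun z => -g z, hg.neg, fun z => ?_⟩
    rw [Complex.exp_neg, hgz, inv_div]
  have htrans : IsTrans α P := by
    refine ⟨?_⟩
    rintro a b c ⟨g, hg, hgz⟩ ⟨k, hk, hkz⟩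
    refine ⟨fun z => g z + k z, hg.add hk, fun z => ?_⟩
    rw [Complex.exp_add, hgz, hkz]
    field_simp [h0]
  refine PreconnectedSpace.induction₂ P (fun a => ?_) htrans a b
  have key : ∀ᶠ b in 𝓝 a, ∀ z ∈ (univ : Set β), F b z / F a z ∈ Complex.slitPlane := by
    refine isCompact_univ.eventually_forall_of_forall_eventually fun z _ => ?_
    have hc : ContinuousAt (fun q : α × β => F q.1 q.2 / F a q.2) (a, z) :=
      hF.continuousAt.div ((hFa a).comp continuous_snd).continuousAt (h0 a z)
    refine hc.eventually_mem (Complex.isOpen_slitPlane.mem_nhds ?_)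
    simp [div_self (h0 a z)]
  filter_upwards [key] with b hb
  exact ⟨fun z => Complex.log (F b z / F a z),
    ((hFa b).div (hFa a) (h0 a)).clog fun z => hb z (mem_univ z),
    fun z => Complex.exp_log (div_ne_zero (h0 b z) (h0 a z))⟩

/-- Two continuous logarithms of the same function on a preconnected set differ by a constant. -/
theorem IsPreconnected.exists_log_eq_add {α : Type*} [TopologicalSpace α] {C : Set α}
    (hC : IsPreconnected C) {f g : α → ℂ} (hf : ContinuousOn f C) (hg : ContinuousOn g C)
    (h : ∀ z ∈ C, Complex.exp (f z) = Complex.exp (g z)) :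
    ∃ k : ℤ, ∀ z ∈ C, f z = g z + k * (2 * Real.pi * Complex.I) := by
  choose! n hn using fun z hz => Complex.exp_eq_exp_iff_exists_int.1 (h z hz)
  rcases C.eq_empty_or_nonempty with rfl | ⟨z₀, hz₀⟩
  · exact ⟨0, by simp⟩
  have hne : (2 * Real.pi * Complex.I : ℂ) ≠ 0 := Complex.two_pi_I_ne_zero
  have hcont : ContinuousOn n C := by
    rw [Int.isClosedEmbedding_coe_real.isInducing.continuousOn_iff]
    have : ContinuousOn (fun z => ((f z - g z) / (2 * Real.pi * Complex.I)).re) C :=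
      Complex.continuous_re.comp_continuousOn ((hf.sub hg).div_const _)
    refine this.congr fun z hz => ?_
    change ((n z : ℤ) : ℝ) = ((f z - g z) / (2 * Real.pi * Complex.I)).re
    rw [hn z hz, add_sub_cancel_left, mul_div_cancel_right₀ _ hne]
    simp
  exact ⟨n z₀, fun z hz => by rw [← hC.constant hcont hz hz₀]; exact hn z hz⟩

/-- A nonvanishing continuous function on the plane has winding number zero along circles. -/
theorem eq_zero_of_eq_zpow_on_sphere {F : ℂ → ℂ} (hF : Continuous F) (h0 : ∀ z, F z ≠ 0)
    {p : ℂ} {R : ℝ} (hR : 0 < R) {c : ℤ} (h : ∀ z ∈ sphere p R, F z = (z - p) ^ c) : c = 0 := by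
  have : CompactSpace (sphere p R) := isCompact_iff_compactSpace.1 (isCompact_sphere p R)
  obtain ⟨g, hg, hgz⟩ := exists_log_div (α := ℝ) (β := sphere p R)
    (F := fun s z => F (p + s * ((z : ℂ) - p))) (by fun_prop) (fun _ _ => h0 _) 0 1
  have hexp : ∀ t : ℝ, p + R * Complex.exp (t * Complex.I) ∈ sphere p R := by
    intro t
    simp [abs_of_pos hR]
  let u : ℝ → ℂ := fun t => g ⟨_, hexp t⟩
  have hu : Continuous u := hg.comp (Continuous.subtype_mk (by fun_prop) _)
  obtain ⟨k, hk⟩ := isPreconnected_univ.exists_log_eq_add (f := u)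
    (g := fun t : ℝ => Complex.log ((R : ℂ) ^ c / F p) + c * (t * Complex.I))
    hu.continuousOn (by fun_prop) (by
      intro t _
      have hR' : (R : ℂ) ≠ 0 := by exact_mod_cast hR.ne'
      have h1 : F (p + R * Complex.exp (t * Complex.I)) = _ := h _ (hexp t)
      simp only [u, hgz]
      rw [Complex.exp_add, Complex.exp_log (div_ne_zero (zpow_ne_zero _ hR') (h0 p)),
        Complex.exp_int_mul]
      simp only [Complex.ofReal_one, one_mul, Complex.ofReal_zero, zero_mul, add_zero,
        add_sub_cancel_left] at h1 ⊢
      rw [h1, mul_zpow]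
      ring)
  have hper : u (2 * Real.pi) = u 0 := by
    simp only [u]
    congr 2
    simp [Complex.exp_two_pi_mul_I]
  have e1 := hk (2 * Real.pi) (mem_univ _)
  have e2 := hk 0 (mem_univ _)
  rw [hper, e2] at e1
  have hne : (2 * Real.pi * Complex.I : ℂ) ≠ 0 := Complex.two_pi_I_ne_zero
  have : (c : ℂ) * (2 * Real.pi * Complex.I) = 0 := by
    push_cast at e1
    linear_combination -e1
  exact_mod_cast (mul_eq_zero.1 this).resolve_right hne

open Classical in
/-- If `∏ (z - p k) ^ d k` has a continuous logarithm on a closed set, then the exponent belonging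
to a bounded complementary domain which contains just one of the points vanishes. -/
theorem exponent_eq_zero_of_log {ι : Type*} [Fintype ι] {p : ι → ℂ} {d : ι → ℤ} {T U : Set ℂ}
    (hT : IsClosed T) (hU : IsOpen U) (hUb : Bornology.IsBounded U) (hUT : frontier U ⊆ T)
    {L : ℂ → ℂ} (hL : ContinuousOn L T)
    (hLT : ∀ z ∈ T, Complex.exp (L z) = ∏ k, (z - p k) ^ d k) (hpT : ∀ k, p k ∉ T) {n : ι}
    (hn : p n ∈ U) (hk : ∀ k, k ≠ n → p k ∉ U) : d n = 0 := by
  obtain ⟨M, hM⟩ := ContinuousMap.exists_restrict_eq hT ⟨T.domRestrict L, hL.domRestrict⟩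
  have hML : ∀ z ∈ T, M z = L z := fun z hz => DFunLike.congr_fun hM ⟨z, hz⟩
  let A : ℂ → ℂ := fun z =>
    Complex.exp (M z) * ∏ k ∈ Finset.univ.erase n, (z - p k) ^ (- d k)
  have hclU : closure U ⊆ U ∪ T := by
    rw [closure_eq_self_union_frontier]
    exact union_subset_union_right _ hUT
  have hA0 : ∀ z ∈ closure U, ∀ k ≠ n, z - p k ≠ 0 := by
    intro z hz k hkn h
    rw [sub_eq_zero] at h
    subst h
    exact (hclU hz).elim (hk k hkn) (hpT k)
  have hpn : ∀ z ∈ closure Uᶜ, z - p n ≠ 0 := by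
    intro z hz h
    rw [hU.isClosed_compl.closure_eq] at hz
    rw [sub_eq_zero] at h
    exact hz (h ▸ hn)
  let F : ℂ → ℂ := U.piecewise A fun z => (z - p n) ^ d n
  have hF : Continuous F := by
    refine continuous_piecewise ?_ ?_ ?_
    · intro z hz
      have hzT := hUT hz
      simp only [A, hML z hzT, hLT z hzT]
      rw [← Finset.mul_prod_erase _ _ (Finset.mem_univ n), mul_assoc, ← Finset.prod_mul_distrib,
        Finset.prod_eq_one, mul_one]
      intro k hk'
      rw [← zpow_add₀ (hA0 z (frontier_subset_closure hz) k (Finset.ne_of_mem_erase hk')),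
        add_neg_cancel, zpow_zero]
    · refine ContinuousOn.mul (by fun_prop) (continuousOn_finsetProd _ fun k hk' => ?_)
      exact ContinuousOn.zpow₀ (by fun_prop) _
        fun z hz => Or.inl (hA0 z hz k (Finset.ne_of_mem_erase hk'))
    · exact ContinuousOn.zpow₀ (by fun_prop) _ fun z hz => Or.inl (hpn z hz)
  have hF0 : ∀ z, F z ≠ 0 := by
    intro z
    by_cases hz : z ∈ U
    · simp only [F, piecewise_eq_of_mem _ _ _ hz, A]
      refine mul_ne_zero (Complex.exp_ne_zero _) (Finset.prod_ne_zero_iff.2 fun k hk' => ?_)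
      exact zpow_ne_zero _ (hA0 z (subset_closure hz) k (Finset.ne_of_mem_erase hk'))
    · simp only [F, piecewise_eq_of_notMem _ _ _ hz]
      exact zpow_ne_zero _ (hpn z (subset_closure hz))
  obtain ⟨R, hR, hUR⟩ := hUb.subset_ball_lt 0 (p n)
  refine eq_zero_of_eq_zpow_on_sphere (p := p n) hF hF0 hR fun z hz => ?_
  refine piecewise_eq_of_notMem _ _ _ fun hzU => ?_
  exact (mem_ball.1 (hUR hzU)).ne hz

theorem exists_log_sub_of_lt_dist {x q : ℂ} {r : ℝ} (hq : r < dist q x) :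
    ∃ k : ℂ → ℂ, ContinuousOn k (closedBall x r) ∧
      ∀ z ∈ closedBall x r, Complex.exp (k z) = z - q := by
  rcases lt_or_ge r 0 with hr | hr
  · exact ⟨0, by simp [closedBall_eq_empty.2 hr], by simp [closedBall_eq_empty.2 hr]⟩
  have hqx : q - x ≠ 0 := by
    rw [← norm_pos_iff, ← dist_eq_norm]
    exact hr.trans_lt hq
  have hs : ∀ z ∈ closedBall x r, 1 + -((z - x) / (q - x)) ∈ Complex.slitPlane := by
    intro z hz
    apply Complex.mem_slitPlane_of_norm_lt_one
    rw [norm_neg, norm_div, ← dist_eq_norm, ← dist_eq_norm, div_lt_one (hr.trans_lt hq)]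
    exact (mem_closedBall.1 hz).trans_lt hq
  refine ⟨fun z => Complex.log (-(q - x)) + Complex.log (1 + -((z - x) / (q - x))),
    continuousOn_const.add (ContinuousOn.clog (by fun_prop) hs), fun z hz => ?_⟩
  rw [Complex.exp_add, Complex.exp_log (neg_ne_zero.2 hqx),
    Complex.exp_log (Complex.slitPlane_ne_zero (hs z hz))]
  field_simp
  ring

theorem exists_log_sub_of_isPreconnected {X U : Set ℂ} (hX : IsCompact X) (hU : IsPreconnected U)
    (hUX : Disjoint U X) {x p : ℂ} {r : ℝ} (hXr : X ⊆ closedBall x r) (hp : p ∈ U)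
    (hUr : ¬ U ⊆ closedBall x r) :
    ∃ g : ℂ → ℂ, ContinuousOn g X ∧ ∀ z ∈ X, Complex.exp (g z) = z - p := by
  obtain ⟨q, hqU, hq⟩ := not_subset.1 hUr
  rw [mem_closedBall, not_le] at hq
  obtain ⟨k, hk, hkz⟩ := exists_log_sub_of_lt_dist hq
  have : PreconnectedSpace U := Subtype.preconnectedSpace hU
  have : CompactSpace X := isCompact_iff_compactSpace.1 hX
  have hne : ∀ (a : U) (z : X), (z : ℂ) - a ≠ 0 := fun a z h =>
    hUX.ne_of_mem a.2 z.2 (sub_eq_zero.1 h).symm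
  obtain ⟨g, hg, hgz⟩ := exists_log_div (α := U) (β := X) (F := fun a z => (z : ℂ) - a)
    (by fun_prop) hne ⟨q, hqU⟩ ⟨p, hp⟩
  obtain ⟨M, hM⟩ := ContinuousMap.exists_restrict_eq hX.isClosed ⟨g, hg⟩
  refine ⟨fun z => k z + M z, (hk.mono hXr).add M.continuous.continuousOn, fun z hz => ?_⟩
  have h1 : M z = g ⟨z, hz⟩ := DFunLike.congr_fun hM ⟨z, hz⟩
  rw [Complex.exp_add, hkz z (hXr hz), h1, hgz]
  have := hne ⟨q, hqU⟩ ⟨z, hz⟩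
  simp only at this ⊢
  field_simp

open Classical in
/-- If the part of a closed set `K` on a circle is covered by `m` connected subsets of `K` in an
annulus, then at most `m + 1` complementary domains cross the annulus. -/
theorem card_le_of_crossing {ι κ : Type*} [Fintype ι] [Fintype κ] {K : Set ℂ} (hK : IsClosed K)
    {x : ℂ} {r₁ r r₂ ε : ℝ} (hr₁ : r₁ < r) (hr₂ : r < r₂) (hε : r₂ ≤ ε)
    {C : κ → Set ℂ} (hC : ∀ j, IsPreconnected (C j)) (hCK : ∀ j, C j ⊆ K)
    (hCr : ∀ j, ∀ z ∈ C j, r₁ ≤ dist z x ∧ dist z x ≤ r₂)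
    (hcov : K ∩ sphere x r ⊆ ⋃ j, C j)
    {p : ι → ℂ} {U : ι → Set ℂ} (hU : ∀ n, IsOpen (U n)) (hUc : ∀ n, IsPreconnected (U n))
    (hUsub : ∀ n, U n ⊆ ball x ε \ K) (hUfr : ∀ n, frontier (U n) ⊆ K ∪ (ball x ε)ᶜ)
    (hdisj : Pairwise (Function.onFun Disjoint U)) (hp : ∀ n, p n ∈ U n)
    (hpr : ∀ n, dist (p n) x < r₁) (hUr : ∀ n, ¬ U n ⊆ closedBall x r₂) :
    Fintype.card ι ≤ Fintype.card κ + 1 := by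
  by_contra! hcard
  obtain ⟨n₀⟩ : Nonempty ι := Fintype.card_pos_iff.1 (by lia)
  have hr₁0 : 0 < r₁ := dist_nonneg.trans_lt (hpr n₀)
  have hg : ∀ n, ∃ g : ℂ → ℂ, ContinuousOn g (K ∩ closedBall x r₂) ∧
      ∀ z ∈ K ∩ closedBall x r₂, Complex.exp (g z) = z - p n := fun n =>
    exists_log_sub_of_isPreconnected ((isCompact_closedBall x r₂).inter_left hK) (hUc n)
      (disjoint_left.2 fun z hz hz' => (hUsub n hz).2 hz'.1) inter_subset_right (hp n) (hUr n)
  choose g hgc hgz using hg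
  have hzx : ∀ z : ℂ, r₁ ≤ dist z x → z - x ≠ 0 := by
    intro z hz
    rw [← norm_pos_iff, ← dist_eq_norm]
    exact hr₁0.trans_le hz
  have hslit : ∀ n, ∀ z : ℂ, r₁ ≤ dist z x → 1 + -((p n - x) / (z - x)) ∈ Complex.slitPlane := by
    intro n z hz
    apply Complex.mem_slitPlane_of_norm_lt_one
    rw [norm_neg, norm_div, ← dist_eq_norm, ← dist_eq_norm, div_lt_one (hr₁0.trans_le hz)]
    exact (hpr n).trans_le hz
  let h : ι → ℂ → ℂ := fun n z => Complex.log (1 + -((p n - x) / (z - x)))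
  have hhc : ∀ n, ContinuousOn (h n) {z | r₁ ≤ dist z x} := fun n =>
    ContinuousOn.clog (continuousOn_const.add (ContinuousOn.neg
      (continuousOn_const.div (by fun_prop) hzx))) (hslit n)
  have hhz : ∀ n, ∀ z : ℂ, r₁ ≤ dist z x → Complex.exp (h n z) = (z - p n) / (z - x) := by
    intro n z hz
    simp only [h]
    rw [Complex.exp_log (Complex.slitPlane_ne_zero (hslit n z hz))]
    field_simp [hzx z hz]
    ring
  have hCX : ∀ j, C j ⊆ K ∩ closedBall x r₂ := fun j z hz => ⟨hCK j hz, (hCr j z hz).2⟩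
  have hCY : ∀ j, C j ⊆ {z | r₁ ≤ dist z x} := fun j z hz => (hCr j z hz).1
  have hpK : ∀ n, ∀ z ∈ K, z - p n ≠ 0 := fun n z hz h0 =>
    (hUsub n (hp n)).2 (sub_eq_zero.1 h0 ▸ hz)
  have ha : ∀ n j, ∃ k : ℤ, ∀ z ∈ C j,
      g n z - h n z = g n₀ z - h n₀ z + k * (2 * Real.pi * Complex.I) := by
    intro n j
    refine (hC j).exists_log_eq_add (((hgc n).mono (hCX j)).sub ((hhc n).mono (hCY j)))
      (((hgc n₀).mono (hCX j)).sub ((hhc n₀).mono (hCY j))) fun z hz => ?_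
    have h1 := hpK n z (hCK j hz)
    have h2 := hpK n₀ z (hCK j hz)
    have h3 := hzx z (hCY j hz)
    rw [Complex.exp_sub, Complex.exp_sub, hgz n z (hCX j hz), hgz n₀ z (hCX j hz),
      hhz n z (hCY j hz), hhz n₀ z (hCY j hz), div_div_cancel₀ h1, div_div_cancel₀ h2]
  choose a ha using ha
  have hdep : ¬ LinearIndependent ℤ (fun n (o : Option κ) => o.elim (1 : ℤ) (a n)) := by
    intro hli
    have := hli.fintype_card_le_finrank
    simp at this
    lia
  obtain ⟨d, hd, n, hdn⟩ := Fintype.not_linearIndependent_iff.1 hdep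
  have hd0 : ∑ n, d n = 0 := by simpa using congrFun hd none
  have hdj : ∀ j, ∑ n, d n * a n j = 0 := fun j => by simpa using congrFun hd (some j)
  have hd0' : ∑ n, (d n : ℂ) = 0 := by exact_mod_cast hd0
  have hdj' : ∀ j, ∑ n, (d n : ℂ) * a n j = 0 := fun j => by exact_mod_cast hdj j
  let L : ℂ → ℂ := (closedBall x r).piecewise (fun z => ∑ n, d n * g n z)
    (fun z => ∑ n, d n * h n z)
  have hcl : closure (closedBall x r)ᶜ ⊆ {z | r ≤ dist z x} :=
    closure_minimal (fun z (hz : ¬ dist z x ≤ r) => (not_le.1 hz).le) (isClosed_le (by fun_prop) (by fun_prop))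
  have hTX : ∀ z ∈ K ∪ (ball x ε)ᶜ, dist z x ≤ r → z ∈ K ∩ closedBall x r₂ := by
    rintro z (hz | hz) hzr
    · exact ⟨hz, hzr.trans hr₂.le⟩
    · exact absurd (mem_ball.2 (hzr.trans_lt (hr₂.trans_le hε))) hz
  have hL : ContinuousOn L (K ∪ (ball x ε)ᶜ) := by
    refine ContinuousOn.piecewise ?_ ?_ ?_
    · rintro z ⟨hzT, hz⟩
      have hzs : dist z x = r := frontier_closedBall_subset_sphere hz
      obtain ⟨j, hj⟩ := mem_iUnion.1 (hcov ⟨(hTX z hzT hzs.le).1, hzs⟩)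
      rw [← sub_eq_zero, ← Finset.sum_sub_distrib]
      calc ∑ n, (d n * g n z - d n * h n z)
          = ∑ n, ((d n : ℂ) * (g n₀ z - h n₀ z)
            + (d n * a n j : ℂ) * (2 * Real.pi * Complex.I)) := by
            refine Finset.sum_congr rfl fun n _ => ?_
            rw [← mul_sub, ha n j z hj]
            ring
        _ = 0 := by
            rw [Finset.sum_add_distrib, ← Finset.sum_mul, ← Finset.sum_mul, hd0', hdj']
            ring
    · rw [isClosed_closedBall.closure_eq]
      refine continuousOn_finsetSum _ fun n _ => continuousOn_const.mul ((hgc n).mono ?_)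
      exact fun z hz => hTX z hz.1 hz.2
    · refine continuousOn_finsetSum _ fun n _ => continuousOn_const.mul ((hhc n).mono ?_)
      exact fun z hz => hr₁.le.trans (hcl hz.2)
  refine hdn (exponent_eq_zero_of_log (hK.union isOpen_ball.isClosed_compl) (hU n)
    (isBounded_ball.subset ((hUsub n).trans sdiff_subset)) (hUfr n) hL ?_ (p := p) ?_ (hp n) ?_)
  · intro z hz
    by_cases hzr : z ∈ closedBall x r
    · simp only [L, piecewise_eq_of_mem _ _ _ hzr, Complex.exp_sum, Complex.exp_int_mul]
      exact Finset.prod_congr rfl fun n _ => by rw [hgz n z (hTX z hz hzr)]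
    · have hz' : r₁ ≤ dist z x := hr₁.le.trans (not_le.1 hzr).le
      simp only [L, piecewise_eq_of_notMem _ _ _ hzr, Complex.exp_sum, Complex.exp_int_mul]
      rw [Finset.prod_congr rfl fun n _ => by rw [hhz n z hz', div_zpow],
        Finset.prod_div_distrib]
      have : ∏ n, (z - x) ^ d n = 1 := by
        rw [← Complex.exp_log (hzx z hz')]
        simp only [← Complex.exp_int_mul, ← Complex.exp_sum, ← Finset.sum_mul, hd0', zero_mul,
          Complex.exp_zero]
      rw [this, div_one]
  · rintro k (hk | hk)
    · exact (hUsub k (hp k)).2 hk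
    · exact hk (hUsub k (hp k)).1
  · exact fun k hkn hk => disjoint_left.1 (hdisj hkn) (hp k) hk

/-- A path whose fibres are order-connected can be reparametrized to be injective. -/
theorem exists_arc_of_ordConnected_fibers {X : Type*} [MetricSpace X] {γ : ℝ → X}
    (hγ : Continuous γ)
    (hfib : ∀ s u t, 0 ≤ s → s ≤ u → u ≤ t → t ≤ 1 → γ s = γ t → γ u = γ s) (hne : γ 0 ≠ γ 1) :
    ∃ φ : ℝ → X, ContinuousOn φ (Icc 0 1) ∧ InjOn φ (Icc 0 1) ∧ φ 1 = γ 1 ∧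
      φ '' Icc 0 1 ⊆ γ '' Icc 0 1 := by
  let D : ℝ → ℝ → ℝ := fun t q => sInf ((fun s => dist (γ q) (γ (s * t))) '' Icc 0 1)
  have hDc : Continuous (Function.uncurry D) :=
    isCompact_Icc.continuous_sInf (f := fun (a : ℝ × ℝ) s => dist (γ a.2) (γ (s * a.1)))
      (by fun_prop)
  have hbdd : ∀ t q, BddBelow ((fun s => dist (γ q) (γ (s * t))) '' Icc 0 1) := fun t q =>
    ⟨0, by rintro _ ⟨s, -, rfl⟩; exact dist_nonneg⟩
  have hDle : ∀ t q v, 0 ≤ v → v ≤ t → D t q ≤ dist (γ q) (γ v) := by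
    intro t q v hv hvt
    refine csInf_le (hbdd t q) ?_
    rcases (hv.trans hvt).eq_or_lt with rfl | ht
    · exact ⟨0, by simp, by simp [le_antisymm hvt hv]⟩
    · exact ⟨v / t, ⟨by positivity, (div_le_one ht).2 hvt⟩, by simp [ht.ne']⟩
  have hDex : ∀ t q, 0 ≤ t → ∃ v, 0 ≤ v ∧ v ≤ t ∧ D t q = dist (γ q) (γ v) := by
    intro t q ht
    obtain ⟨s, hs, hs'⟩ := isCompact_Icc.exists_sInf_image_eq (nonempty_Icc.2 zero_le_one)
      (f := fun s : ℝ => dist (γ q) (γ (s * t))) (by fun_prop)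
    exact ⟨s * t, mul_nonneg hs.1 ht, mul_le_of_le_one_left ht hs.2, hs'⟩
  let M : ℝ → ℝ := fun t => ∫ q in (0 : ℝ)..1, D t q
  have hMc : Continuous M :=
    intervalIntegral.continuous_parametric_intervalIntegral_of_continuous' hDc 0 1
  have hDq : ∀ t, Continuous (D t) := fun t => hDc.comp (Continuous.prodMk_right t)
  have hDanti : ∀ s t q, 0 ≤ s → s ≤ t → D t q ≤ D s q := by
    intro s t q hs hst
    obtain ⟨v, hv, hvs, h⟩ := hDex s q hs
    exact h ▸ hDle t q v hv (hvs.trans hst)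
  have hlt : ∀ s t, 0 ≤ s → s ≤ t → t ≤ 1 → γ s ≠ γ t → M t < M s := by
    intro s t hs hst ht h
    refine intervalIntegral.integral_lt_integral_of_continuousOn_of_le_of_exists_lt zero_lt_one
      (hDq t).continuousOn (hDq s).continuousOn (fun q _ => hDanti s t q hs hst)
      ⟨t, ⟨hs.trans hst, ht⟩, ?_⟩
    obtain ⟨v, hv, hvs, hD⟩ := hDex s t hs
    have h1 : D t t ≤ 0 := by simpa using hDle t t t (hs.trans hst) le_rfl
    refine h1.trans_lt ?_
    rw [hD, dist_pos]
    intro hvt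
    have h2 := hfib v s t hv hvs hst ht hvt.symm
    exact h (h2.trans hvt.symm)
  have heq : ∀ s t, 0 ≤ s → s ≤ t → t ≤ 1 → γ s = γ t → M s = M t := by
    intro s t hs hst ht h
    have : D s = D t := by
      funext q
      refine le_antisymm ?_ (hDanti s t q hs hst)
      obtain ⟨v, hv, hvt, hD⟩ := hDex t q (hs.trans hst)
      rw [hD]
      rcases le_total v s with hvs | hsv
      · exact hDle s q v hv hvs
      · rw [hfib s v t hs hsv hvt ht h]
        exact hDle s q s hs le_rfl
    simp only [M, this]
  have hM01 : 0 < M 0 - M 1 := sub_pos.2 (hlt 0 1 le_rfl zero_le_one le_rfl hne)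
  have hMiff : ∀ s ∈ Icc (0 : ℝ) 1, ∀ t ∈ Icc (0 : ℝ) 1, M s = M t ↔ γ s = γ t := by
    intro s hs t ht
    rcases le_total s t with h | h
    · exact ⟨fun h' => by_contra fun h'' => (hlt s t hs.1 h ht.2 h'').ne' h',
        heq s t hs.1 h ht.2⟩
    · exact ⟨fun h' => by_contra fun h'' => (hlt t s ht.1 h hs.2 (Ne.symm h'')).ne h',
        fun h' => (heq t s ht.1 h hs.2 h'.symm).symm⟩
  have hManti : ∀ s t, 0 ≤ s → s ≤ t → t ≤ 1 → M t ≤ M s := by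
    intro s t hs hst ht
    by_cases h : γ s = γ t
    · exact (heq s t hs hst ht h).ge
    · exact (hlt s t hs hst ht h).le
  let m : ℝ → ℝ := fun t => (M 0 - M t) / (M 0 - M 1)
  have hmc : Continuous m := by fun_prop
  have hm0 : m 0 = 0 := by simp [m]
  have hm1 : m 1 = 1 := div_self hM01.ne'
  have hmaps : MapsTo m (Icc 0 1) (Icc 0 1) := by
    intro t ht
    refine ⟨div_nonneg (sub_nonneg.2 (hManti 0 t le_rfl ht.1 ht.2)) hM01.le,
      (div_le_one hM01).2 (sub_le_sub_left (hManti t 1 ht.1 ht.2 le_rfl) _)⟩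
  have hmiff : ∀ s ∈ Icc (0 : ℝ) 1, ∀ t ∈ Icc (0 : ℝ) 1, m s = m t ↔ γ s = γ t := by
    intro s hs t ht
    rw [← hMiff s hs t ht]
    simp only [m]
    rw [div_left_inj' hM01.ne', sub_right_inj]
  have hsurj : ∀ y ∈ Icc (0 : ℝ) 1, ∃ t ∈ Icc (0 : ℝ) 1, m t = y := by
    have := intermediate_value_Icc (zero_le_one (α := ℝ)) hmc.continuousOn
    rw [hm0, hm1] at this
    exact fun y hy => this hy
  choose! ρ hρ hmρ using hsurj
  refine ⟨γ ∘ ρ, ?_, ?_, ?_, ?_⟩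
  · have hq : Topology.IsQuotientMap (hmaps.restrict m _ _) :=
      Topology.IsQuotientMap.of_surjective_continuous
        (fun y => ⟨⟨ρ y, hρ y y.2⟩, Subtype.ext (hmρ y y.2)⟩)
        (hmc.continuousOn.mapsToRestrict hmaps)
    rw [continuousOn_iff_continuous_domRestrict, hq.continuous_iff]
    refine (hγ.comp continuous_subtype_val).congr fun t => ?_
    have ht' := hmaps t.2
    exact ((hmiff _ (hρ _ ht') _ t.2).1 (hmρ _ ht')).symm
  · intro a ha b hb hab
    rw [← hmρ a ha, ← hmρ b hb]
    exact (hmiff _ (hρ a ha) _ (hρ b hb)).2 hab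
  · have h1 : (1 : ℝ) ∈ Icc (0 : ℝ) 1 := ⟨zero_le_one, le_rfl⟩
    exact (hmiff _ (hρ 1 h1) _ h1).1 ((hmρ 1 h1).trans hm1.symm)
  · rintro _ ⟨y, hy, rfl⟩
    exact ⟨ρ y, hρ y hy, rfl⟩

/-- Among the closed subsets of the unit interval which contain both ends and such that `γ` agrees
at the two ends of each complementary gap, there is one on which `γ` takes equal values only at the
two ends of a gap. -/
theorem exists_minimal_gap_set {X : Type*} [MetricSpace X] {γ : ℝ → X} (hγ : Continuous γ) :
    ∃ S : Set ℝ, S ⊆ Icc 0 1 ∧ IsClosed S ∧ 0 ∈ S ∧ 1 ∈ S ∧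
      (∀ a ∈ S, ∀ b ∈ S, a < b → Disjoint (Ioo a b) S → γ a = γ b) ∧
      (∀ a ∈ S, ∀ b ∈ S, a < b → γ a = γ b → Disjoint (Ioo a b) S) := by
  let 𝓕 : Set (Set ℝ) := {S | S ⊆ Icc 0 1 ∧ IsClosed S ∧ 0 ∈ S ∧ 1 ∈ S ∧
      ∀ a ∈ S, ∀ b ∈ S, a < b → Disjoint (Ioo a b) S → γ a = γ b}
  have h01 : Icc (0 : ℝ) 1 ∈ 𝓕 := by
    refine ⟨subset_rfl, isClosed_Icc, by simp, by simp, fun a ha b hb hab hd => ?_⟩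
    obtain ⟨c, hc⟩ := exists_between hab
    exact (disjoint_left.1 hd hc ⟨ha.1.trans hc.1.le, hc.2.le.trans hb.2⟩).elim
  obtain ⟨S, -, hS⟩ := zorn_superset_nonempty 𝓕 (fun c hc hchain hcne => by
    obtain ⟨s₀, hs₀⟩ := hcne
    refine ⟨⋂₀ c, ⟨(sInter_subset_of_mem hs₀).trans (hc hs₀).1,
      isClosed_sInter fun s hs => (hc hs).2.1, fun s hs => (hc hs).2.2.1,
      fun s hs => (hc hs).2.2.2.1, fun a ha b hb hab hd => ?_⟩, fun s hs => sInter_subset_of_mem hs⟩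
    refine eq_of_forall_dist_le fun ε hε => ?_
    obtain ⟨δ₁, hδ₁, h₁⟩ := Metric.continuous_iff.1 hγ a (ε / 2) (half_pos hε)
    obtain ⟨δ₂, hδ₂, h₂⟩ := Metric.continuous_iff.1 hγ b (ε / 2) (half_pos hε)
    obtain ⟨η, hη, hηmin⟩ := exists_between
      (lt_min (lt_min hδ₁ hδ₂) (half_pos (sub_pos.2 hab)))
    rw [lt_min_iff, lt_min_iff] at hηmin
    obtain ⟨⟨hη₁, hη₂⟩, hη₃⟩ := hηmin
    have : Nonempty c := ⟨⟨s₀, hs₀⟩⟩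
    obtain ⟨⟨s, hs⟩, hsd⟩ := (isCompact_Icc (a := a + η) (b := b - η)).elim_directed_family_closed
      (fun s : c => (s : Set ℝ)) (fun s => (hc s.2).2.1) (by
        rw [← sInter_eq_iInter, ← disjoint_iff_inter_eq_empty]
        exact hd.mono_left (Icc_subset_Ioo (by linarith) (by linarith)))
      (by
        intro s t
        rcases hchain.total s.2 t.2 with h | h
        · exact ⟨s, subset_rfl, h⟩
        · exact ⟨t, h, subset_rfl⟩)
    obtain ⟨-, hscl, -, -, hsgap⟩ := hc hs
    obtain ⟨a', ha', ha'max⟩ := (isCompact_Icc.inter_left hscl).exists_isGreatest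
      ⟨a, ha s hs, left_mem_Icc.2 (show a ≤ a + η by linarith)⟩
    obtain ⟨b', hb', hb'min⟩ := (isCompact_Icc.inter_left hscl).exists_isLeast
      ⟨b, hb s hs, right_mem_Icc.2 (show b - η ≤ b by linarith)⟩
    have hgap : γ a' = γ b' := by
      refine hsgap a' ha'.1 b' hb'.1 (by linarith [ha'.2.2, hb'.2.1]) ?_
      refine disjoint_left.2 fun u hu hus => ?_
      by_cases hu1 : u ≤ a + η
      · exact (ha'max ⟨hus, ha'.2.1.trans hu.1.le, hu1⟩).not_gt hu.1
      by_cases hu2 : b - η ≤ u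
      · exact (hb'min ⟨hus, hu2, hu.2.le.trans hb'.2.2⟩).not_gt hu.2
      · exact (hsd ▸ (⟨⟨(not_le.1 hu1).le, (not_le.1 hu2).le⟩, hus⟩ :
          u ∈ Icc (a + η) (b - η) ∩ s) : u ∈ (∅ : Set ℝ))
    have e1 := h₁ a' (by
      rw [Real.dist_eq, abs_of_nonneg (sub_nonneg.2 ha'.2.1)]
      linarith [ha'.2.2])
    have e2 := h₂ b' (by
      rw [Real.dist_eq, abs_of_nonpos (sub_nonpos.2 hb'.2.2)]
      linarith [hb'.2.1])
    rw [← hgap] at e2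
    linarith [dist_triangle_left (γ a) (γ b) (γ a')]) _ h01
  obtain ⟨hS01, hScl, h0, h1, hgap⟩ := hS.prop
  refine ⟨S, hS01, hScl, h0, h1, hgap, fun s hs t ht hst hγst => ?_⟩
  have hmem : S \ Ioo s t ∈ 𝓕 := by
    refine ⟨sdiff_subset.trans hS01, hScl.sdiff isOpen_Ioo,
      ⟨h0, fun h => h.1.not_ge (hS01 hs).1⟩, ⟨h1, fun h => h.2.not_ge (hS01 ht).2⟩, ?_⟩
    rintro a ⟨ha, ha'⟩ b ⟨hb, hb'⟩ hab hd
    by_cases h : Disjoint (Ioo a b) S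
    · exact hgap a ha b hb hab h
    obtain ⟨c, hc, hcS⟩ := not_disjoint_iff.1 h
    have hcst : c ∈ Ioo s t := by
      by_contra hcst
      exact disjoint_left.1 hd hc ⟨hcS, hcst⟩
    have has : a ≤ s := not_lt.1 fun h' => ha' ⟨h', hc.1.trans hcst.2⟩
    have htb : t ≤ b := not_lt.1 fun h' => hb' ⟨hcst.1.trans hc.2, h'⟩
    have hsa : s ≤ a := not_lt.1 fun h' =>
      disjoint_left.1 hd ⟨h', hcst.1.trans hc.2⟩ ⟨hs, fun h => h.1.false⟩
    have hbt : b ≤ t := not_lt.1 fun h' =>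
      disjoint_left.1 hd ⟨hc.1.trans hcst.2, h'⟩ ⟨ht, fun h => h.2.false⟩
    rw [le_antisymm has hsa, le_antisymm hbt htb, hγst]
  exact disjoint_right.2 fun u hu => (hS.le_of_le hmem sdiff_subset hu).2

/-- The image of a path with distinct end points contains an arc with one prescribed end point. -/
theorem exists_arc_of_continuous {X : Type*} [MetricSpace X] {γ : ℝ → X} (hγ : Continuous γ)
    (hne : γ 0 ≠ γ 1) :
    ∃ φ : ℝ → X, ContinuousOn φ (Icc 0 1) ∧ InjOn φ (Icc 0 1) ∧ φ 1 = γ 1 ∧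
      φ '' Icc 0 1 ⊆ γ '' Icc 0 1 := by
  obtain ⟨S, hS01, hScl, h0, h1, hgap, hinj⟩ := exists_minimal_gap_set hγ
  have hmax : ∀ t : Icc (0 : ℝ) 1, ∃ a, IsGreatest (S ∩ Icc 0 t) a := fun t =>
    (isCompact_Icc.inter_left hScl).exists_isGreatest ⟨0, h0, le_rfl, t.2.1⟩
  choose σ hσ using hmax
  have hσmono : ∀ s t, s ≤ t → σ s ≤ σ t := fun s t hst =>
    (hσ t).2 ⟨(hσ s).1.1, (hσ s).1.2.1, (hσ s).1.2.2.trans hst⟩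
  have hmod : ∀ s t : Icc (0 : ℝ) 1, s ≤ t → γ (σ s) = γ (σ t) ∨
      ∃ b ∈ Icc (s : ℝ) t, γ (σ s) = γ b ∧ σ t ∈ Icc (s : ℝ) t := by
    intro s t hst
    by_cases h : σ s = σ t
    · exact Or.inl (by rw [h])
    have hlt : σ s < σ t := lt_of_le_of_ne (hσmono s t hst) h
    have hst' : (s : ℝ) < σ t := not_le.1 fun h' =>
      hlt.not_ge ((hσ s).2 ⟨(hσ t).1.1, (hσ t).1.2.1, h'⟩)
    obtain ⟨b, hb, hbmin⟩ := (isCompact_Icc.inter_left hScl).exists_isLeast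
      ⟨σ t, (hσ t).1.1, hst'.le, (hσ t).1.2.2⟩
    refine Or.inr ⟨b, hb.2, ?_, hst'.le, (hσ t).1.2.2⟩
    rcases ((hσ s).1.2.2.trans hb.2.1).eq_or_lt with h' | h'
    · rw [h']
    refine hgap _ (hσ s).1.1 b hb.1 h' (disjoint_left.2 fun u hu huS => ?_)
    rcases le_total u s with hus | hsu
    · exact ((hσ s).2 ⟨huS, (hS01 huS).1, hus⟩).not_gt hu.1
    · exact (hbmin ⟨huS, hsu, hu.2.le.trans hb.2.2⟩).not_gt hu.2
  have huc := isCompact_Icc.uniformContinuousOn_of_continuous (hγ.continuousOn (s := Icc 0 1))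
  have hσc : Continuous (γ ∘ σ) := by
    refine UniformContinuous.continuous (Metric.uniformContinuous_iff.2 fun ε hε => ?_)
    obtain ⟨δ, hδ, h⟩ := Metric.uniformContinuousOn_iff.1 huc ε hε
    refine ⟨δ, hδ, fun {s t} hst => ?_⟩
    have key : ∀ s t : Icc (0 : ℝ) 1, s ≤ t → dist s t < δ → dist (γ (σ s)) (γ (σ t)) < ε := by
      intro s t hle hst
      rcases hmod s t hle with h' | ⟨b, hb, h', hσt⟩
      · rwa [h', dist_self]
      · rw [h']
        refine h b ⟨s.2.1.trans hb.1, hb.2.trans t.2.2⟩ _ (hS01 (hσ t).1.1) ?_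
        exact (Real.dist_le_of_mem_Icc hb hσt).trans_lt (by
          rwa [Subtype.dist_eq, dist_comm, Real.dist_eq,
            abs_of_nonneg (sub_nonneg.2 (show (s : ℝ) ≤ t from hle))] at hst)
    rcases le_total s t with hle | hle
    · exact key s t hle hst
    · rw [dist_comm] at hst ⊢
      exact key t s hle hst
  have hσS : ∀ t : Icc (0 : ℝ) 1, (t : ℝ) ∈ S → σ t = t := fun t ht =>
    le_antisymm (hσ t).1.2.2 ((hσ t).2 ⟨ht, t.2.1, le_rfl⟩)
  let P : ℝ → Icc (0 : ℝ) 1 := projIcc 0 1 zero_le_one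
  have hP0 : σ (P 0) = 0 := by simp only [P, projIcc_left]; exact hσS ⟨0, _⟩ h0
  have hP1 : σ (P 1) = 1 := by simp only [P, projIcc_right]; exact hσS ⟨1, _⟩ h1
  obtain ⟨φ, hφ, hφinj, hφ1, hφim⟩ := exists_arc_of_ordConnected_fibers
    (γ := γ ∘ σ ∘ P) (hσc.comp continuous_projIcc) (by
      intro s u t _ hsu hut _ h
      have h1 := hσmono _ _ (monotone_projIcc zero_le_one hsu)
      have h2 := hσmono _ _ (monotone_projIcc zero_le_one hut)
      simp only [Function.comp_apply] at h ⊢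
      rcases h1.eq_or_lt with h1 | h1
      · rw [← h1]
      rcases h2.eq_or_lt with h2 | h2
      · exact h2 ▸ h.symm
      exact (disjoint_left.1 (hinj _ (hσ _).1.1 _ (hσ _).1.1 (h1.trans h2) h) ⟨h1, h2⟩
        (hσ _).1.1).elim) (by simpa [hP0, hP1] using hne)
  refine ⟨φ, hφ, hφinj, by simpa [hP1] using hφ1, hφim.trans ?_⟩
  rintro _ ⟨t, -, rfl⟩
  exact ⟨σ (P t), hS01 (hσ _).1.1, rfl⟩

/-- Concatenation of infinitely many paths which shrink to a point. -/
theorem exists_continuous_of_joinedIn {X : Type*} [MetricSpace X] {C : ℕ → Set X}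
    (hC : Antitone C) {w : ℕ → X} (hw : ∀ k, JoinedIn (C k) (w k) (w (k + 1))) {x : X}
    (hx : ∀ ε > 0, ∃ k, C k ⊆ ball x ε) :
    ∃ γ : ℝ → X, Continuous γ ∧ γ 1 = x ∧ ∀ t < 1, γ t ∈ C 0 := by
  let δ : ℕ → ℝ → X := fun k => (hw k).somePath.extend
  have hδc : ∀ k, Continuous (δ k) := fun k => (hw k).somePath.continuous_extend
  have hδC : ∀ k t, δ k t ∈ C k := fun k t => (hw k).somePath_mem _
  let η : ℝ → X := fun t => δ ⌊t⌋₊ (t - ⌊t⌋₊)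
  have hηC : ∀ k : ℕ, ∀ t : ℝ, k ≤ t → η t ∈ C k := fun k t ht => hC (Nat.le_floor ht) (hδC _ _)
  have hηIcc : ∀ k : ℕ, ContinuousOn η (Icc k (k + 1)) := by
    intro k
    have : Continuous fun t : ℝ => δ k (t - k) := (hδc k).comp (by fun_prop)
    refine this.continuousOn.congr fun t ht => ?_
    rcases ht.2.eq_or_lt with rfl | hlt
    · have hfl : ⌊(k : ℝ) + 1⌋₊ = k + 1 := by exact_mod_cast Nat.floor_natCast (R := ℝ) (k + 1)
      simp [η, hfl, δ]
    · have hfl : ⌊t⌋₊ = k := (Nat.floor_eq_iff (k.cast_nonneg.trans ht.1)).2 ⟨ht.1, hlt⟩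
      simp only [η, hfl]
  have hηIic : ∀ k : ℕ, ContinuousOn η (Iic k) := by
    intro k
    induction k with
    | zero =>
      refine (hδc 0).continuousOn.congr fun t ht => ?_
      have hfl : ⌊t⌋₊ = 0 := Nat.floor_of_nonpos (by simpa using ht)
      simp [η, hfl]
    | succ k ih =>
      have : Iic ((k + 1 : ℕ) : ℝ) = Iic (k : ℝ) ∪ Icc (k : ℝ) (k + 1) := by
        rw [Iic_union_Icc_eq_Iic (by linarith)]
        push_cast
        rfl
      rw [this]
      exact ih.union_of_isClosed (hηIcc k) isClosed_Iic isClosed_Icc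
  have hη : Continuous η := by
    refine continuous_iff_continuousAt.2 fun t => ?_
    obtain ⟨k, hk⟩ := exists_nat_gt t
    exact (hηIic k).continuousAt (Iic_mem_nhds hk)
  let γ : ℝ → X := fun t => if t < 1 then η (t / (1 - t)) else x
  have hγ1 : γ 1 = x := if_neg (lt_irrefl _)
  refine ⟨γ, ?_, hγ1, fun t ht => ?_⟩
  · refine continuous_iff_continuousAt.2 fun t => ?_
    rcases lt_trichotomy t 1 with ht | rfl | ht
    · have : ContinuousAt (fun t => η (t / (1 - t))) t :=
        hη.continuousAt.comp (continuousAt_id.div (by fun_prop) (sub_pos.2 ht).ne')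
      refine this.congr ?_
      filter_upwards [Iio_mem_nhds ht] with s hs
      exact (if_pos hs).symm
    · refine Metric.tendsto_nhds.2 fun ε hε => ?_
      obtain ⟨k, hk⟩ := hx ε hε
      have h1 : (k : ℝ) / (k + 1) < 1 := by
        rw [div_lt_one (by positivity)]
        linarith
      filter_upwards [Ioi_mem_nhds h1] with s hs
      rw [hγ1]
      by_cases hs1 : s < 1
      · simp only [γ, if_pos hs1]
        refine hk (hηC k _ ?_)
        rw [mem_Ioi, div_lt_iff₀ (by positivity)] at hs
        rw [le_div_iff₀ (sub_pos.2 hs1)]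
        linarith
      · simpa only [γ, if_neg hs1, dist_self] using hε
    · refine continuousAt_const.congr (f := fun _ => x) ?_
      filter_upwards [Ioi_mem_nhds ht] with s hs
      exact (if_neg (not_lt.2 (le_of_lt hs))).symm
  · simp only [γ, if_pos ht]
    exact hC (Nat.zero_le _) (hδC _ _)

theorem exists_mem_closure_inter_of_finite {X : Type*} [MetricSpace X] {A : Set X} {x : X}
    (hx : x ∈ closure A) {δ : ℝ} (hδ : 0 < δ) {𝒞 : Set (Set X)} (h𝒞 : 𝒞.Finite)
    (hA : A ∩ ball x δ ⊆ ⋃₀ 𝒞) : ∃ c ∈ 𝒞, x ∈ closure (A ∩ c) := by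
  have h1 : x ∈ closure (A ∩ ball x δ) := by
    rw [Metric.mem_closure_iff] at hx ⊢
    intro ε hε
    obtain ⟨b, hb, hxb⟩ := hx (min ε δ) (lt_min hε hδ)
    exact ⟨b, ⟨hb, by rw [mem_ball, dist_comm]; exact hxb.trans_le (min_le_right _ _)⟩,
      hxb.trans_le (min_le_left _ _)⟩
  have h2 : A ∩ ball x δ ⊆ ⋃ c ∈ 𝒞, A ∩ c := by
    intro y hy
    obtain ⟨c, hc, hyc⟩ := hA hy
    exact mem_biUnion hc ⟨hy.1, hyc⟩
  have h3 := closure_mono h2 h1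
  rw [h𝒞.closure_biUnion] at h3
  simpa using h3

/-- A boundary point `x` of an open set `W` is the end of an arc in `W` if near `x` there are only
finitely many components of the intersection of `W` with any ball about `x`. -/
theorem exists_arc_of_finite_components {W : Set ℂ} (hW : IsOpen W) {x : ℂ}
    (hx : x ∈ closure W) (hxW : x ∉ W)
    (hfin : ∀ ε > 0, ∃ δ > 0, (connectedComponentIn (W ∩ ball x ε) '' (W ∩ ball x δ)).Finite) :
    ∃ φ : ℝ → ℂ, ContinuousOn φ (Icc 0 1) ∧ InjOn φ (Icc 0 1) ∧ φ 1 = x ∧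
      φ '' Ico 0 1 ⊆ W := by
  have hstep : ∀ A ⊆ W, x ∈ closure A → ∀ ε > 0,
      ∃ z, x ∈ closure (A ∩ connectedComponentIn (W ∩ ball x ε) z) := by
    intro A hAW hA ε hε
    obtain ⟨δ, hδ, hf⟩ := hfin ε hε
    obtain ⟨_, ⟨z, -, rfl⟩, hz⟩ := exists_mem_closure_inter_of_finite hA (lt_min hδ hε) hf (by
      rintro y ⟨hyA, hy⟩
      have h1 := ball_subset_ball (min_le_left _ _) hy
      have h2 := ball_subset_ball (min_le_right _ _) hy
      exact ⟨_, ⟨y, ⟨hAW hyA, h1⟩, rfl⟩, mem_connectedComponentIn ⟨hAW hyA, h2⟩⟩)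
    exact ⟨z, hz⟩
  let ε : ℕ → ℝ := fun k => 1 / (k + 1)
  have hε : ∀ k, 0 < ε k := fun k => Nat.one_div_pos_of_nat
  have hεanti : ∀ k, ε (k + 1) ≤ ε k := fun k => Nat.one_div_le_one_div k.le_succ
  let Q : ℕ → Set ℂ → Prop := fun k c =>
    x ∈ closure c ∧ ∃ z, c = connectedComponentIn (W ∩ ball x (ε k)) z
  have hQ0 : ∃ c, Q 0 c := by
    obtain ⟨z, hz⟩ := hstep W subset_rfl hx (ε 0) (hε 0)
    exact ⟨_, closure_mono inter_subset_right hz, z, rfl⟩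
  have hQs : ∀ k c, Q k c → ∃ c', Q (k + 1) c' ∧ c' ⊆ c := by
    rintro k c ⟨hc, z, rfl⟩
    obtain ⟨z', hz'⟩ := hstep _ ((connectedComponentIn_subset _ _).trans inter_subset_left) hc
      (ε (k + 1)) (hε _)
    refine ⟨_, ⟨closure_mono inter_subset_right hz', z', rfl⟩, ?_⟩
    obtain ⟨y, hy, hy'⟩ := closure_nonempty_iff.1 ⟨x, hz'⟩
    rw [connectedComponentIn_eq hy]
    exact isPreconnected_connectedComponentIn.subset_connectedComponentIn hy'
      ((connectedComponentIn_subset _ _).trans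
        (inter_subset_inter_right _ (ball_subset_ball (hεanti k))))
  choose! next hnext hnext_sub using hQs
  obtain ⟨c₀, hc₀⟩ := hQ0
  let C : ℕ → Set ℂ := fun k => Nat.rec c₀ next k
  have hC : ∀ k, Q k (C k) := by
    intro k
    induction k with
    | zero => exact hc₀
    | succ k ih => exact hnext k _ ih
  have hCanti : Antitone C := antitone_nat_of_succ_le fun k => hnext_sub k _ (hC k)
  have hCsub : ∀ k, C k ⊆ W ∩ ball x (ε k) := by
    intro k
    obtain ⟨-, z, hz⟩ := hC k
    exact hz ▸ connectedComponentIn_subset _ _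
  have hCne : ∀ k, (C k).Nonempty := fun k => closure_nonempty_iff.1 ⟨x, (hC k).1⟩
  have hCpath : ∀ k, IsPathConnected (C k) := by
    intro k
    obtain ⟨-, z, hz⟩ := hC k
    have ho : IsOpen (C k) := hz ▸ (hW.inter isOpen_ball).connectedComponentIn
    exact ho.isConnected_iff_isPathConnected.1
      ⟨hCne k, hz ▸ isPreconnected_connectedComponentIn⟩
  choose w hw using hCne
  obtain ⟨γ, hγ, hγ1, hγC⟩ := exists_continuous_of_joinedIn hCanti (x := x)
    (fun k => (hCpath k).joinedIn _ (hw k) _ (hCanti k.le_succ (hw (k + 1)))) (by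
      intro r hr
      obtain ⟨k, hk⟩ := exists_nat_one_div_lt hr
      exact ⟨k, (hCsub k).trans (inter_subset_right.trans (ball_subset_ball hk.le))⟩)
  have hγW : ∀ t < 1, γ t ∈ W := fun t ht => (hCsub 0 (hγC t ht)).1
  obtain ⟨φ, hφ, hφinj, hφ1, hφim⟩ := exists_arc_of_continuous hγ
    (fun h => hxW (by simpa [h, hγ1] using hγW 0 one_pos))
  refine ⟨φ, hφ, hφinj, hφ1.trans hγ1, ?_⟩
  rintro _ ⟨t, ht, rfl⟩
  obtain ⟨s, hs, hst⟩ := hφim ⟨t, Ico_subset_Icc_self ht, rfl⟩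
  rcases hs.2.eq_or_lt with rfl | hs1
  · have := hφinj (Ico_subset_Icc_self ht) ⟨zero_le_one, le_rfl⟩ (hst.symm.trans hφ1.symm)
    exact absurd this ht.2.ne
  · exact hst ▸ hγW s hs1

/-- Near a boundary point, an unbounded domain `W` has only finitely many local components if the
complementary set `K` satisfies a finite covering property by small connected subsets. -/
theorem finite_components_of_cover {K W : Set ℂ} (hK : IsClosed K)
    (hcov : ∀ O S : Set ℂ, IsOpen O → IsCompact S → S ⊆ O → ∃ 𝒞 : Set (Set ℂ), 𝒞.Finite ∧
      (∀ c ∈ 𝒞, IsPreconnected c ∧ c ⊆ K ∩ O) ∧ K ∩ S ⊆ ⋃₀ 𝒞)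
    (hW : IsOpen W) (hWc : IsPreconnected W) (hWb : ¬ Bornology.IsBounded W)
    (hWK : Disjoint W K) (hWfr : frontier W ⊆ K) {x : ℂ} {ε : ℝ} (hε : 0 < ε) :
    ∃ δ > 0, (connectedComponentIn (W ∩ ball x ε) '' (W ∩ ball x δ)).Finite := by
  have hr₁ : ε / 4 < ε / 2 := by linarith
  have hr₂ : ε / 2 < 3 * ε / 4 := by linarith
  have hr₃ : 3 * ε / 4 < ε := by linarith
  refine ⟨ε / 4, by linarith, ?_⟩
  have hO : IsOpen {z | ε / 4 < dist z x ∧ dist z x < 3 * ε / 4} :=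
    isOpen_Ioo.preimage (continuous_id.dist continuous_const)
  obtain ⟨𝒞, h𝒞, h𝒞c, hS⟩ := hcov _ (sphere x (ε / 2)) hO
    (isCompact_sphere _ _) (fun z hz => by
      rw [mem_sphere] at hz
      exact ⟨by rw [hz]; exact hr₁, by rw [hz]; exact hr₂⟩)
  have := h𝒞.fintype
  by_contra hinf
  obtain ⟨s, hs, hcard⟩ := Set.Infinite.exists_subset_card_eq hinf (Fintype.card 𝒞 + 2)
  choose p hp hpU using fun c : s => hs c.2
  have hWO : IsOpen (W ∩ ball x ε) := hW.inter isOpen_ball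
  have hsub : ∀ c : s, (c : Set ℂ) ⊆ W ∩ ball x ε := fun c =>
    hpU c ▸ connectedComponentIn_subset _ _
  have hopen : ∀ c : s, IsOpen (c : Set ℂ) := fun c => hpU c ▸ hWO.connectedComponentIn
  have hmem : ∀ c : s, p c ∈ (c : Set ℂ) := fun c => by
    have h : p c ∈ W ∩ ball x ε := ⟨(hp c).1, ball_subset_ball (by linarith) (hp c).2⟩
    have := mem_connectedComponentIn h
    rwa [hpU c] at this
  have heq : ∀ c : s, ∀ y ∈ (c : Set ℂ), connectedComponentIn (W ∩ ball x ε) y = c := by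
    intro c y hy
    rw [← hpU c] at hy ⊢
    exact (connectedComponentIn_eq hy).symm
  have hfr : ∀ c : s, frontier (c : Set ℂ) ⊆ K ∪ (ball x ε)ᶜ := by
    intro c y hy
    by_contra hyK
    rw [mem_union, not_or, mem_compl_iff, not_not] at hyK
    have hycl : y ∈ closure (c : Set ℂ) := frontier_subset_closure hy
    have hyW : y ∈ W := by
      by_contra hyW
      refine hyK.1 (hWfr ⟨closure_mono ((hsub c).trans inter_subset_left) hycl, ?_⟩)
      rwa [hW.interior_eq]
    have hyWO : y ∈ W ∩ ball x ε := ⟨hyW, hyK.2⟩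
    obtain ⟨u, hu, huc⟩ := mem_closure_iff.1 hycl _ (hWO.connectedComponentIn (x := y))
      (mem_connectedComponentIn hyWO)
    have : y ∈ (c : Set ℂ) := by
      rw [← heq c u huc, ← connectedComponentIn_eq hu]
      exact mem_connectedComponentIn hyWO
    exact ((hopen c).frontier_eq ▸ hy).2 this
  have hcross := card_le_of_crossing hK hr₁ hr₂ hr₃.le (C := fun c : 𝒞 => (c : Set ℂ))
    (fun c => (h𝒞c c c.2).1) (fun c => (h𝒞c c c.2).2.trans inter_subset_left)
    (fun c z hz => ⟨((h𝒞c c c.2).2 hz).2.1.le, ((h𝒞c c c.2).2 hz).2.2.le⟩)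
    (by rwa [← sUnion_eq_iUnion]) (p := p) (U := fun c : s => (c : Set ℂ)) hopen
    (fun c => hpU c ▸ isPreconnected_connectedComponentIn)
    (fun c z hz => ⟨(hsub c hz).2, fun hzK => disjoint_left.1 hWK (hsub c hz).1 hzK⟩)
    hfr
    (fun c c' hne => disjoint_left.2 fun z hz hz' =>
      hne (Subtype.ext ((heq c z hz).symm.trans (heq c' z hz'))))
    hmem (fun c => (hp c).2)
    (fun c hc => by
      refine hWb ((isBounded_closedBall (x := x) (r := 3 * ε / 4)).subset (Subset.trans ?_ hc))
      refine hWc.subset_of_closure_inter_subset (hopen c) ⟨p c, (hp c).1, hmem c⟩ ?_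
      rintro y ⟨hy, hyW⟩
      by_contra hyc
      rcases hfr c ⟨hy, by rwa [(hopen c).interior_eq]⟩ with h | h
      · exact disjoint_left.1 hWK hyW h
      · have := closure_minimal hc isClosed_closedBall hy
        exact h (mem_ball.2 ((mem_closedBall.1 this).trans_lt hr₃)))
  rw [Fintype.card_coe, hcard] at hcross
  lia

theorem exists_finite_cover_of_locallyConnectedSpace {X : Type*} [TopologicalSpace X] {V : Set X}
    (hV : IsClosed V) [LocallyConnectedSpace V] {O S : Set X} (hO : IsOpen O) (hS : IsCompact S)
    (hSO : S ⊆ O) :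
    ∃ 𝒞 : Set (Set X), 𝒞.Finite ∧ (∀ c ∈ 𝒞, IsPreconnected c ∧ c ⊆ V ∩ O) ∧ V ∩ S ⊆ ⋃₀ 𝒞 := by
  have hO' : IsOpen ((↑) ⁻¹' O : Set V) := hO.preimage continuous_subtype_val
  obtain ⟨t, -, ht⟩ := (hV.isClosedEmbedding_subtypeVal.isCompact_preimage hS).elim_nhds_subcover
    (connectedComponentIn ((↑) ⁻¹' O : Set V))
    (fun y hy => connectedComponentIn_mem_nhds (hO'.mem_nhds (hSO hy)))
  refine ⟨(fun y => (↑) '' connectedComponentIn ((↑) ⁻¹' O : Set V) y) '' (t : Set V),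
    t.finite_toSet.image _, ?_, ?_⟩
  · rintro _ ⟨y, -, rfl⟩
    refine ⟨isPreconnected_connectedComponentIn.image _ continuous_subtype_val.continuousOn, ?_⟩
    rintro _ ⟨u, hu, rfl⟩
    have : u ∈ ((↑) ⁻¹' O : Set V) := connectedComponentIn_subset _ _ hu
    exact ⟨u.2, this⟩
  · rintro z ⟨hzV, hzS⟩
    obtain ⟨y, hy, hzy⟩ := mem_iUnion₂.1 (ht (show (⟨z, hzV⟩ : V) ∈ _ from hzS))
    exact ⟨_, ⟨y, hy, rfl⟩, ⟨z, hzV⟩, hzy, rfl⟩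

theorem exists_finite_cover_iUnion {X ι : Type*} [TopologicalSpace X] [Finite ι] {V : ι → Set X}
    (hV : ∀ i, IsClosed (V i)) [∀ i, LocallyConnectedSpace (V i)] {O S : Set X} (hO : IsOpen O)
    (hS : IsCompact S) (hSO : S ⊆ O) :
    ∃ 𝒞 : Set (Set X), 𝒞.Finite ∧ (∀ c ∈ 𝒞, IsPreconnected c ∧ c ⊆ (⋃ i, V i) ∩ O) ∧
      (⋃ i, V i) ∩ S ⊆ ⋃₀ 𝒞 := by
  choose 𝒞 hfin hc hcov using fun i =>
    exists_finite_cover_of_locallyConnectedSpace (hV i) hO hS hSO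
  refine ⟨⋃ i, 𝒞 i, finite_iUnion hfin, fun c h => ?_, ?_⟩
  · obtain ⟨i, hi⟩ := mem_iUnion.1 h
    exact ⟨(hc i c hi).1, (hc i c hi).2.trans (inter_subset_inter_left _ (subset_iUnion V i))⟩
  · rintro z ⟨hz, hzS⟩
    obtain ⟨i, hi⟩ := mem_iUnion.1 hz
    obtain ⟨c, h, hzc⟩ := hcov i ⟨hi, hzS⟩
    exact ⟨c, mem_iUnion.2 ⟨i, h⟩, hzc⟩

theorem Convex.locallyConnectedSpace {E : Type*} [NormedAddCommGroup E] [NormedSpace ℝ E]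
    {s : Set E} (hs : Convex ℝ s) : LocallyConnectedSpace s := by
  refine locallyConnectedSpace_of_connected_bases (fun x r => ball x r) (fun _ r => 0 < r)
    (fun x => nhds_basis_ball) fun x r _ => ?_
  rw [← Topology.IsInducing.subtypeVal.isPreconnected_image]
  have : ((↑) '' ball x r : Set E) = s ∩ ball (x : E) r := by
    ext y
    constructor
    · rintro ⟨y, hy, rfl⟩
      exact ⟨y.2, hy⟩
    · rintro ⟨hy, hyr⟩
      exact ⟨⟨y, hy⟩, hyr, rfl⟩
  rw [this]
  exact (hs.inter (convex_ball _ _)).isPreconnected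

theorem frontier_connectedComponentIn_compl_subset {X : Type*} [TopologicalSpace X]
    [LocallyConnectedSpace X] {K : Set X} (hK : IsClosed K) (x : X) :
    frontier (connectedComponentIn Kᶜ x) ⊆ K := by
  intro y hy
  by_contra hyK
  obtain ⟨u, hu, hux⟩ := mem_closure_iff.1 (frontier_subset_closure hy) _
    (hK.isOpen_compl.connectedComponentIn (x := y)) (mem_connectedComponentIn hyK)
  rw [connectedComponentIn_eq hux, ← connectedComponentIn_eq hu,
    hK.isOpen_compl.connectedComponentIn.frontier_eq] at hy
  exact hy.2 (mem_connectedComponentIn hyK)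

theorem stmt_8 (n : ℕ) (V : Fin n → Set Plane)
    (hclosed : ∀ i, IsClosed (V i))
    (hdisk : ∀ i, Nonempty ((V i) ≃ₜ (closedBall (0 : Plane) 1)))
    (hconn : IsConnected (⋃ i, interior (V i)))
    (W : Set Plane)
    (hWcomp : ∃ x ∈ (⋃ i, V i)ᶜ, W = connectedComponentIn (⋃ i, V i)ᶜ x)
    (hWunbounded : ¬ Bornology.IsBounded W) :
    ∀ x ∈ frontier W, Accessible W x := by
  intro x hx
  obtain ⟨z, -, hWz⟩ := hWcomp
  have hK : IsClosed (⋃ i, V i) := isClosed_iUnion_of_finite hclosed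
  have hW : IsOpen W := hWz ▸ hK.isOpen_compl.connectedComponentIn
  let e : Plane ≃ₗᵢ[ℝ] ℂ := Complex.orthonormalBasisOneI.repr.symm
  let V' : Fin n → Set ℂ := fun i => e.toHomeomorph '' V i
  have hK' : (⋃ i, V' i) = e.toHomeomorph '' ⋃ i, V i := (image_iUnion).symm
  have hV' : ∀ i, IsClosed (V' i) := fun i => e.toHomeomorph.isClosed_image.2 (hclosed i)
  have hlc : ∀ i, LocallyConnectedSpace (V' i) := by
    intro i
    have := (convex_closedBall (0 : Plane) 1).locallyConnectedSpace
    obtain ⟨h⟩ := hdisk i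
    exact ((e.toHomeomorph.image (V i)).symm.trans h).locallyConnectedSpace
  have hWo : IsOpen (e.toHomeomorph '' W) := e.toHomeomorph.isOpen_image.2 hW
  have hxfr : e x ∈ frontier (e.toHomeomorph '' W) := by
    rw [← e.toHomeomorph.image_frontier]
    exact ⟨x, hx, rfl⟩
  obtain ⟨φ, hφ, hφinj, hφ1, hφW⟩ := exists_arc_of_finite_components hWo
    (frontier_subset_closure hxfr) (fun h => (hWo.frontier_eq ▸ hxfr).2 h)
    fun ε hε => finite_components_of_cover (K := ⋃ i, V' i) (isClosed_iUnion_of_finite hV')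
      (fun O S hO hS hSO => exists_finite_cover_iUnion hV' hO hS hSO) hWo
      (by
        rw [hWz]
        exact isPreconnected_connectedComponentIn.image _ e.toHomeomorph.continuous.continuousOn)
      (fun hb => hWunbounded (by
        have := e.symm.lipschitz.isBounded_image hb
        rwa [show e.symm '' (e.toHomeomorph '' W) = W from e.toEquiv.symm_image_image W] at this))
      (by
        rw [hK', disjoint_image_iff e.toHomeomorph.injective, hWz]
        exact disjoint_left.2 fun y hy => connectedComponentIn_subset _ _ hy)
      (by
        rw [hK', ← e.toHomeomorph.image_frontier, hWz]
        exact image_mono (frontier_connectedComponentIn_compl_subset hK z))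
      hε
  refine ⟨e.symm ∘ φ, e.symm.continuous.comp_continuousOn hφ, e.symm.injective.comp_injOn hφinj,
    by simp [hφ1], ?_⟩
  rintro _ ⟨t, ht, rfl⟩
  obtain ⟨w, hw, hwt⟩ := hφW ⟨t, ht, rfl⟩
  rw [Function.comp_apply, ← hwt]
  change e.symm (e w) ∈ W
  rwa [e.symm_apply_apply]
end

section
/- Let V₁, …, Vₙ be finitely many closed subsets of ℝ², each homeomorphic to the closed disk, with ⋃ᵢ int Vᵢ connected, and let W be the unbounded component of ℝ² \ ⋃ᵢ Vᵢ. Then the interior of ℝ² \ W is connected. -/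
open Metric Set

open scoped Topology

theorem IsClosed.exists_continuous_eqOn {s : Set ℂ} (hs : IsClosed s) {f : ℂ → ℂ}
    (hf : ContinuousOn f s) : ∃ g : ℂ → ℂ, Continuous g ∧ EqOn g f s := by
  obtain ⟨g, hg⟩ := ContinuousMap.exists_restrict_eq hs
    ⟨s.domRestrict f, continuousOn_iff_continuous_domRestrict.mp hf⟩
  exact ⟨g, g.continuous, fun x hx => congr($hg ⟨x, hx⟩)⟩

theorem Continuous.exists_continuous_exp_eq {F : ℂ → ℂ} (hF : Continuous F) (h0 : ∀ z, F z ≠ 0) :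
    ∃ ℓ : ℂ → ℂ, Continuous ℓ ∧ ∀ z, Complex.exp (ℓ z) = F z := by
  obtain ⟨ℓ, ⟨-, hℓ⟩, -⟩ := Complex.isCoveringMapOn_exp.existsUnique_continuousMap_lifts
    ⟨F, hF⟩ (a₀ := 0) (Complex.exp_log (h0 0)) h0
  exact ⟨ℓ, ℓ.continuous, fun z => congr_fun hℓ z⟩

theorem IsPreconnected.eqOn_const_of_exp_eq_one {X : Type*} [TopologicalSpace X] {T : Set X}
    (hT : IsPreconnected T) {u : X → ℂ} (hu : ContinuousOn u T)
    (h1 : ∀ z ∈ T, Complex.exp (u z) = 1) :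
    ∃ c, Complex.exp c = 1 ∧ ∀ z ∈ T, u z = c := by
  rcases T.eq_empty_or_nonempty with rfl | ⟨x, hx⟩
  · exact ⟨0, by simp⟩
  refine ⟨u x, h1 x hx, fun z hz => ?_⟩
  have hc : ContinuousOn (fun z => u z / (2 * Real.pi * Complex.I)) T := hu.div_const _
  have hd : IsDiscrete (range ((↑) : ℤ → ℂ)) :=
    Complex.isClosedEmbedding_intCast.isEmbedding.isDiscrete_range
  have := hT.constant_of_mapsTo hd hc (fun z hz => ?_) hz hx
  · field_simp at this
    simpa using this
  · obtain ⟨n, hn⟩ := Complex.exp_eq_one_iff.1 (h1 z hz)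
    exact ⟨n, by simp [hn]⟩

theorem exists_continuousOn_exp_eq_div {X C : Set ℂ} (hX : IsClosed X) (hC : IsPreconnected C)
    (hCX : Disjoint C X) {a b : ℂ} (ha : a ∈ C) (hb : b ∈ C) :
    ∃ ℓ : ℂ → ℂ, ContinuousOn ℓ X ∧ ∀ z ∈ X, Complex.exp (ℓ z) = (z - a) / (z - b) := by
  have hne : ∀ x ∈ C, ∀ z ∈ X, z - x ≠ 0 := fun x hx z hz h =>
    hCX.le_bot ⟨hx, by rwa [← sub_eq_zero.1 h]⟩
  refine hC.induction₂ (fun a b => ∃ ℓ : ℂ → ℂ, ContinuousOn ℓ X ∧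
    ∀ z ∈ X, Complex.exp (ℓ z) = (z - a) / (z - b)) (fun x hx => ?_) ?_ ?_ ha hb
  · obtain ⟨r, hr, hrX⟩ := Metric.isOpen_iff.1 hX.isOpen_compl x (disjoint_left.1 hCX hx)
    filter_upwards [inter_mem_nhdsWithin C (ball_mem_nhds x hr)] with y hy
    have hs : ∀ z ∈ X, (z - y) / (z - x) ∈ Complex.slitPlane := fun z hz => by
      have h0 := hne x hx z hz
      have hz' : r ≤ ‖z - x‖ := by
        by_contra! h
        exact hrX (mem_ball_iff_norm.2 h) hz
      have : (z - y) / (z - x) = 1 + (x - y) / (z - x) := by field_simp; ring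
      rw [this]
      apply Complex.mem_slitPlane_of_norm_lt_one
      rw [norm_div, div_lt_one (norm_pos_iff.2 h0)]
      exact (mem_ball_iff_norm'.1 hy.2).trans_le hz'
    refine ⟨fun z => -Complex.log ((z - y) / (z - x)), ?_, fun z hz => ?_⟩
    · exact (ContinuousOn.clog (ContinuousOn.div (by fun_prop) (by fun_prop) (hne x hx)) hs).neg
    · rw [Complex.exp_neg, Complex.exp_log (Complex.slitPlane_ne_zero (hs z hz)), inv_div]
  · rintro x y w hx hy hw ⟨ℓ, hℓ, hℓ'⟩ ⟨m, hm, hm'⟩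
    refine ⟨fun z => ℓ z + m z, hℓ.add hm, fun z hz => ?_⟩
    rw [Complex.exp_add, hℓ' z hz, hm' z hz, div_mul_div_cancel₀ (hne y hy z hz)]
  · rintro x y hx hy ⟨ℓ, hℓ, hℓ'⟩
    exact ⟨fun z => -ℓ z, hℓ.neg, fun z hz => by rw [Complex.exp_neg, hℓ' z hz, inv_div]⟩

theorem exists_eq_zero_of_eq_sub {F : ℂ → ℂ} (hF : Continuous F) {a : ℂ} {R : ℝ}
    (hR : ∀ z, R ≤ ‖z‖ → F z = z - a) : ∃ z, F z = 0 := by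
  by_contra! h0
  obtain ⟨ℓ, hℓ, hexp⟩ := hF.exists_continuous_exp_eq h0
  set r : ℝ := max R (‖a‖ + 1)
  have hr : 0 < r := (by positivity : 0 < ‖a‖ + 1).trans_le (le_max_right _ _)
  have hra : ‖a‖ < r := (lt_add_one _).trans_le (le_max_right _ _)
  have hr0 : (r : ℂ) ≠ 0 := by exact_mod_cast hr.ne'
  let γ : ℝ → ℂ := fun t => r * Complex.exp (t * Complex.I)
  have hγ : Continuous γ := by fun_prop
  have hγn : ∀ t, ‖γ t‖ = r := fun t => by
    simp [γ, Complex.norm_exp_ofReal_mul_I, abs_of_pos hr]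
  have hγ0 : ∀ t, γ t ≠ 0 := fun t => norm_pos_iff.1 (by rw [hγn]; exact hr)
  have hs : ∀ t, 1 + -a / γ t ∈ Complex.slitPlane := fun t => by
    apply Complex.mem_slitPlane_of_norm_lt_one
    rwa [norm_div, norm_neg, hγn, div_lt_one hr]
  have hu : Continuous fun t : ℝ =>
      ℓ (γ t) - Complex.log (1 + -a / γ t) - Complex.log r - t * Complex.I := by
    refine (((hℓ.comp hγ).sub (Continuous.clog ?_ hs)).sub continuous_const).sub (by fun_prop)
    exact continuous_const.add (continuous_const.div hγ hγ0)
  obtain ⟨c, -, hc⟩ := isPreconnected_univ.eqOn_const_of_exp_eq_one hu.continuousOn (fun t _ => by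
    rw [Complex.exp_sub, Complex.exp_sub, Complex.exp_sub, hexp,
      hR _ (by rw [hγn]; exact le_max_left _ _),
      Complex.exp_log (Complex.slitPlane_ne_zero (hs t)), Complex.exp_log hr0]
    have h1 : γ t - a ≠ 0 := fun h => by
      have := hγn t
      rw [sub_eq_zero.1 h] at this
      exact hra.ne this
    have h2 : 1 + -a / γ t = (γ t - a) / γ t := by field_simp [hγ0 t]; ring
    have h3 := hγ0 t
    have h4 : (r : ℂ) * Complex.exp (t * Complex.I) = γ t := rfl
    rw [h2, div_div_cancel₀ h1, div_div, h4, div_self h3])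
  have h0 := hc 0 trivial
  have h1 := hc (2 * Real.pi) trivial
  have hγ2 : γ (2 * Real.pi) = γ 0 := by simp [γ, Complex.exp_two_pi_mul_I]
  rw [← h0, hγ2] at h1
  have : ((2 * Real.pi : ℝ) : ℂ) * Complex.I = (0 : ℝ) * Complex.I := by linear_combination -h1
  simp [Real.pi_ne_zero] at this

theorem not_exists_exp_eq_div_on_frontier {B : Set ℂ}
    (hBb : Bornology.IsBounded B) {a b : ℂ} (ha : a ∈ B) (hb : b ∉ closure B) :
    ¬ ∃ ℓ : ℂ → ℂ, ContinuousOn ℓ (frontier B) ∧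
      ∀ z ∈ frontier B, Complex.exp (ℓ z) = (z - a) / (z - b) := by
  classical
  rintro ⟨ℓ, hℓ, hexp⟩
  obtain ⟨g, hg, hgℓ⟩ := isClosed_frontier.exists_continuous_eqOn hℓ
  obtain ⟨R, hR⟩ := hBb.subset_ball 0
  have hF : Continuous (B.piecewise (fun z => (z - b) * Complex.exp (g z)) (fun z => z - a)) := by
    refine Continuous.piecewise (fun z hz => ?_) (by fun_prop) (by fun_prop)
    have : z - b ≠ 0 := sub_ne_zero.2 fun h => hb (h ▸ frontier_subset_closure hz)
    rw [hgℓ hz, hexp z hz]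
    field_simp
  obtain ⟨z, hz⟩ := exists_eq_zero_of_eq_sub hF (a := a) (R := R) fun z hz =>
    piecewise_eq_of_notMem _ _ _ fun h => by
      have := mem_ball_zero_iff.1 (hR h)
      linarith
  by_cases hzB : z ∈ B
  · rw [piecewise_eq_of_mem _ _ _ hzB, mul_eq_zero] at hz
    have := hz.resolve_right (Complex.exp_ne_zero _)
    exact hb (sub_eq_zero.1 this ▸ subset_closure hzB)
  · rw [piecewise_eq_of_notMem _ _ _ hzB] at hz
    exact hzB (sub_eq_zero.1 hz ▸ ha)

theorem exists_continuousOn_exp_eq_div_diff_ball {V B W : Set ℂ} (hV : IsClosed V)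
    (hB : IsPreconnected B) (hW : IsPreconnected W) (hBV : Disjoint B V) (hWV : Disjoint W V)
    {a b p : ℂ} (ha : a ∈ B) (hb : b ∈ W) (hpB : p ∈ closure B) (hpW : p ∈ closure W)
    {δ : ℝ} (hδ : 0 < δ) :
    ∃ ℓ : ℂ → ℂ, ContinuousOn ℓ (V \ ball p δ) ∧
      ∀ z ∈ V \ ball p δ, Complex.exp (ℓ z) = (z - a) / (z - b) := by
  have hball : IsPreconnected (ball p δ) := (convex_ball p δ).isPreconnected
  have h1 : IsPreconnected (B ∪ ball p δ) := hB.union'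
    ((mem_closure_iff.1 hpB _ isOpen_ball (mem_ball_self hδ)).mono fun x hx => hx.symm) hball
  have h2 : IsPreconnected (B ∪ ball p δ ∪ W) := h1.union'
    ((mem_closure_iff.1 hpW _ isOpen_ball (mem_ball_self hδ)).mono
      fun x hx => ⟨Or.inr hx.1, hx.2⟩) hW
  refine exists_continuousOn_exp_eq_div (hV.sdiff isOpen_ball) h2 ?_ (Or.inl (Or.inl ha))
    (Or.inr hb)
  rw [disjoint_union_left, disjoint_union_left]
  exact ⟨⟨hBV.mono_right sdiff_subset, disjoint_sdiff_right⟩, hWV.mono_right sdiff_subset⟩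

theorem exists_continuousOn_exp_eq_div_of_two_points {V B W : Set ℂ} (hV : IsClosed V)
    (hB : IsPreconnected B) (hW : IsPreconnected W) (hBV : Disjoint B V) (hWV : Disjoint W V)
    {a b p q : ℂ} (ha : a ∈ B) (hb : b ∈ W) (hpB : p ∈ closure B) (hpW : p ∈ closure W)
    (hqB : q ∈ closure B) (hqW : q ∈ closure W) (hpq : p ≠ q)
    (hT : ∀ ε > 0, ∃ δ > 0, ∃ T, IsPreconnected T ∧ T ⊆ V \ (ball p δ ∪ ball q δ) ∧
      V \ (ball p ε ∪ ball q ε) ⊆ T) :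
    ∃ ℓ : ℂ → ℂ, ContinuousOn ℓ V ∧ ∀ z ∈ V, Complex.exp (ℓ z) = (z - a) / (z - b) := by
  classical
  set ε := dist p q / 3
  have hd : 0 < dist p q := dist_pos.2 hpq
  have hε : 0 < ε := by positivity
  obtain ⟨δ₀, hδ₀, T, hTc, hTV, hVT⟩ := hT ε hε
  set δ := min δ₀ ε
  have hδ : 0 < δ := lt_min hδ₀ hε
  have hbp : ball p δ ⊆ ball p δ₀ := ball_subset_ball (min_le_left _ _)
  have hbq : ball q δ ⊆ ball q δ₀ := ball_subset_ball (min_le_left _ _)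
  have hδε : δ ≤ ε := min_le_right _ _
  obtain ⟨ℓ, hℓ, hℓe⟩ := exists_continuousOn_exp_eq_div_diff_ball hV hB hW hBV hWV ha hb hpB hpW hδ
  obtain ⟨m, hm, hme⟩ := exists_continuousOn_exp_eq_div_diff_ball hV hB hW hBV hWV ha hb hqB hqW hδ
  have hTp : T ⊆ V \ ball p δ := fun z hz => ⟨(hTV hz).1, fun h => (hTV hz).2 (Or.inl (hbp h))⟩
  have hTq : T ⊆ V \ ball q δ := fun z hz => ⟨(hTV hz).1, fun h => (hTV hz).2 (Or.inr (hbq h))⟩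
  have hne : ∀ z ∈ V, (z - a) / (z - b) ≠ 0 := fun z hz => div_ne_zero
    (sub_ne_zero.2 fun h => disjoint_left.1 hBV ha (h ▸ hz))
    (sub_ne_zero.2 fun h => disjoint_left.1 hWV hb (h ▸ hz))
  obtain ⟨c, hc, hcT⟩ := hTc.eqOn_const_of_exp_eq_one ((hℓ.mono hTp).sub (hm.mono hTq))
    (fun z hz => by
      rw [Pi.sub_apply, Complex.exp_sub, hℓe z (hTp hz), hme z (hTq hz),
        div_self (hne z (hTV hz).1)])
  have hfar : ∀ z, dist z p < 2 * ε → ε < dist z q := fun z hz => by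
    have := dist_triangle_left p q z
    have : dist p q = 3 * ε := by simp only [ε]; ring
    linarith
  have hagree : ∀ z ∈ V, ε ≤ dist z p → ε ≤ dist z q → ℓ z = m z + c := fun z hz h1 h2 => by
    have := hcT z (hVT ⟨hz, by simp [h1, h2]⟩)
    rw [← this, Pi.sub_apply]
    ring
  refine ⟨(ball p ε).piecewise (fun z => m z + c) ℓ, fun z hz => ?_, fun z hz => ?_⟩
  · by_cases hzp : dist z p < 2 * ε
    · have hnear : ∀ᶠ w in 𝓝[V] z, w ∈ V ∧ ε < dist w q := by
        filter_upwards [self_mem_nhdsWithin, nhdsWithin_le_nhds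
          ((continuous_id.dist continuous_const).continuousAt.eventually_const_lt (hfar z hzp))]
          with w hw hw' using ⟨hw, hw'⟩
      have hcont : ContinuousWithinAt (fun z => m z + c) V z := by
        refine ContinuousWithinAt.add ?_ continuousWithinAt_const
        refine (hm z ⟨hz, fun h => ?_⟩).mono_of_mem_nhdsWithin ?_
        · linarith [hfar z hzp, mem_ball.1 h]
        · filter_upwards [hnear] with w hw
          exact ⟨hw.1, fun h => by linarith [hw.2, mem_ball.1 h]⟩
      refine hcont.congr_of_eventuallyEq_of_mem ?_ hz
      filter_upwards [hnear] with w hw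
      by_cases hwp : w ∈ ball p ε
      · exact piecewise_eq_of_mem _ _ _ hwp
      · rw [piecewise_eq_of_notMem _ _ _ hwp]
        exact hagree w hw.1 (by simpa using hwp) hw.2.le
    · have hnear : ∀ᶠ w in 𝓝[V] z, w ∈ V ∧ ε < dist w p := by
        filter_upwards [self_mem_nhdsWithin, nhdsWithin_le_nhds
          ((continuous_id.dist continuous_const).continuousAt.eventually_const_lt
            (show ε < dist z p by linarith))]
          with w hw hw' using ⟨hw, hw'⟩
      have hcont : ContinuousWithinAt ℓ V z := by
        refine (hℓ z ⟨hz, fun h => ?_⟩).mono_of_mem_nhdsWithin ?_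
        · linarith [mem_ball.1 h]
        · filter_upwards [hnear] with w hw
          exact ⟨hw.1, fun h => by linarith [hw.2, mem_ball.1 h]⟩
      refine hcont.congr_of_eventuallyEq_of_mem ?_ hz
      filter_upwards [hnear] with w hw
      exact piecewise_eq_of_notMem _ _ _ fun h => by linarith [hw.2, mem_ball.1 h]
  · by_cases hzp : z ∈ ball p ε
    · have := hfar z (by linarith [mem_ball.1 hzp])
      rw [piecewise_eq_of_mem _ _ _ hzp, Complex.exp_add, hc, mul_one, hme z ⟨hz, fun h => ?_⟩]
      linarith [mem_ball.1 h]
    · rw [piecewise_eq_of_notMem _ _ _ hzp, hℓe z ⟨hz, fun h => hzp (ball_subset_ball hδε h)⟩]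

/-- A nowhere zero continuous function on a compact subset of a circle extends to the whole circle
without zeros. -/
theorem exists_continuous_ne_zero_on_sphere_eqOn {G : ℂ → ℂ} (hG : Continuous G) {A : Set ℂ}
    (hA : IsCompact A) {c : ℂ} {ε : ℝ} (hGA : ∀ z ∈ A, G z ≠ 0) :
    ∃ N : ℂ → ℂ, Continuous N ∧ (∀ z ∈ sphere c ε, N z ≠ 0) ∧ EqOn N G A := by
  obtain ⟨η, hη, hηA⟩ : ∃ η > 0, ∀ z ∈ A, η ≤ ‖G z‖ := by
    rcases A.eq_empty_or_nonempty with rfl | hne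
    · exact ⟨1, one_pos, by simp⟩
    · obtain ⟨z, hz, hmin⟩ := hA.exists_isMinOn hne hG.norm.continuousOn
      exact ⟨‖G z‖, norm_pos_iff.2 (hGA z hz), fun w hw => hmin hw⟩
  obtain ⟨P, hP, hPG, -⟩ := hG.exists_contDiff_approx 1 (ε := fun _ => η / 2) continuous_const
    (fun _ => half_pos hη)
  have hPs : ContDiff ℝ 1 (fun t : ℝ => P (circleMap c ε t)) :=
    hP.comp (contDiff_circleMap c ε)
  obtain ⟨v, hv, hvr⟩ := (hPs.dense_compl_range_of_finrank_lt_finrank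
    (by simp [Complex.finrank_real_complex])).exists_mem_open isOpen_ball
    ⟨0, mem_ball_self (half_pos hη)⟩
  have hs : ∀ z ∈ A, (P z - v) / G z ∈ Complex.slitPlane := fun z hz => by
    have h0 := hGA z hz
    have : (P z - v) / G z = 1 + (P z - G z - v) / G z := by field_simp; ring
    rw [this]
    apply Complex.mem_slitPlane_of_norm_lt_one
    rw [norm_div, div_lt_one (norm_pos_iff.2 h0)]
    have h1 := hPG z
    rw [dist_eq_norm] at h1
    have h2 := mem_ball_zero_iff.1 hvr
    linarith [norm_sub_le (P z - G z) v, hηA z hz]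
  have hPc : Continuous P := hP.continuous
  obtain ⟨g, hg, hgA⟩ := hA.isClosed.exists_continuous_eqOn
    (ContinuousOn.clog ((hPc.sub continuous_const).continuousOn.div hG.continuousOn hGA) hs)
  refine ⟨fun z => (P z - v) * Complex.exp (-g z), by fun_prop, fun z hz => ?_, fun z hz => ?_⟩
  · refine mul_ne_zero (sub_ne_zero.2 fun h => hv ?_) (Complex.exp_ne_zero _)
    have hz' : z ∈ sphere c |ε| := by
      rwa [abs_of_nonneg (by rw [← mem_sphere.1 hz]; exact dist_nonneg)]
    rw [← range_circleMap] at hz'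
    obtain ⟨t, rfl⟩ := hz'
    exact ⟨t, h⟩
  · have h0 := hGA z hz
    have h1 : P z - v ≠ 0 := fun h => by
      have := Complex.slitPlane_ne_zero (hs z hz)
      simp [h] at this
    have hgz : g z = Complex.log ((P z - v) / G z) := hgA hz
    simp only
    rw [Complex.exp_neg, hgz, Complex.exp_log (Complex.slitPlane_ne_zero (hs z hz))]
    field_simp

/-- Invariance of domain for a disk in the plane. -/
theorem mem_interior_image_closedBall {h : ℂ → ℂ} (hc : ContinuousOn h (closedBall 0 1))
    (hinj : InjOn h (closedBall 0 1)) {x : ℂ} (hx : x ∈ ball (0 : ℂ) 1) :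
    h x ∈ interior (h '' closedBall 0 1) := by
  classical
  obtain ⟨H, hH, hHh⟩ := isClosed_closedBall.exists_continuous_eqOn hc
  rw [← hHh.image_eq, ← hHh (ball_subset_closedBall hx)]
  replace hinj := hinj.congr hHh.symm
  clear hHh hc
  by_contra hint
  have hK : IsCompact (H '' closedBall 0 1) := (isCompact_closedBall 0 1).image hH
  obtain ⟨G, hG⟩ := ContinuousMap.exists_extension' (e := (closedBall (0 : ℂ) 1).domRestrict H)
    ((hH.comp continuous_subtype_val).isClosedEmbedding (injOn_iff_injective.1 hinj))
    ⟨fun w => w.1 - x, by fun_prop⟩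
  have hGH : ∀ w ∈ closedBall (0 : ℂ) 1, G (H w) = w - x := fun w hw => congr_fun hG ⟨w, hw⟩
  have hxJ : H x ∉ H '' sphere 0 1 := by
    rintro ⟨s, hs, hsx⟩
    rw [hinj (sphere_subset_closedBall hs) (ball_subset_closedBall hx) hsx] at hs
    exact (mem_ball.1 hx).ne (mem_sphere.1 hs)
  obtain ⟨r, hr, hrJ⟩ := Metric.isOpen_iff.1
    ((isCompact_sphere 0 1).image hH).isClosed.isOpen_compl (H x) hxJ
  have hcl : H x ∈ closure (H '' closedBall 0 1)ᶜ := by rwa [closure_compl]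
  obtain ⟨c, hcK, hcx⟩ := Metric.mem_closure_iff.1 hcl (r / 2) (half_pos hr)
  set ε := r / 2
  have hε : 0 < ε := half_pos hr
  have hrε : r = ε + ε := (add_halves r).symm
  have hcJ : ∀ w ∈ sphere (0 : ℂ) 1, ε < dist (H w) c := fun w hw => by
    by_contra! hle
    refine hrJ ?_ (mem_image_of_mem H hw)
    rw [mem_ball]
    linarith [dist_triangle (H w) c (H x), dist_comm c (H x)]
  obtain ⟨N, hN, hN0, hNG⟩ := exists_continuous_ne_zero_on_sphere_eqOn (c := c) (ε := ε)
    G.continuous (hK.inter_right (isClosed_sphere (x := c) (ε := ε))) (by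
      rintro _ ⟨⟨w, hw, rfl⟩, hwc⟩
      rw [hGH w hw, sub_ne_zero]
      rintro rfl
      exact hcx.ne hwc)
  set E : Set ℂ := closedBall 0 1 ∩ H ⁻¹' ball c ε
  have hEcl : closure E ⊆ closedBall 0 1 ∩ H ⁻¹' closedBall c ε :=
    closure_minimal (inter_subset_inter_right _ (preimage_mono ball_subset_closedBall))
      (isClosed_closedBall.inter (isClosed_closedBall.preimage hH))
  have hEball : ∀ w ∈ E, w ∈ ball (0 : ℂ) 1 := fun w hw => by
    refine (mem_closedBall.1 hw.1).lt_of_ne fun h => ?_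
    exact (hcJ w h).not_gt hw.2
  have hEopen : IsOpen E := by
    have : E = ball 0 1 ∩ H ⁻¹' ball c ε :=
      Subset.antisymm (fun w hw => ⟨hEball w hw, hw.2⟩)
        (inter_subset_inter_left _ ball_subset_closedBall)
    rw [this]
    exact isOpen_ball.inter (isOpen_ball.preimage hH)
  have hne : ∀ w ∈ closedBall (0 : ℂ) 1, H w - c ≠ 0 := fun w hw h =>
    hcK ⟨w, hw, sub_eq_zero.1 h⟩
  let π : ℂ → ℂ := fun w => c + ε * ((H w - c) / ‖H w - c‖)
  have hπ : ContinuousOn π (closedBall 0 1) := by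
    refine continuousOn_const.add (continuousOn_const.mul (ContinuousOn.div (by fun_prop)
      (by fun_prop) fun w hw => ?_))
    exact_mod_cast norm_ne_zero_iff.2 (hne w hw)
  have hπs : ∀ w ∈ closedBall (0 : ℂ) 1, π w ∈ sphere c ε := fun w hw => by
    have := norm_ne_zero_iff.2 (hne w hw)
    simp [π, abs_of_pos hε, this]
  have hF : Continuous (E.piecewise (fun w => N (π w)) (fun w => w - x)) := by
    refine continuous_piecewise (fun w hw => ?_) ?_ (by fun_prop)
    · have hw1 := hEcl (frontier_subset_closure hw)
      have hw2 : dist (H w) c = ε := by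
        refine (mem_closedBall.1 hw1.2).antisymm (not_lt.1 fun hlt => ?_)
        rw [hEopen.frontier_eq] at hw
        exact hw.2 ⟨hw1.1, hlt⟩
      have hπw : π w = H w := by
        have h1 : (ε : ℂ) ≠ 0 := by exact_mod_cast hε.ne'
        simp only [π]
        rw [← dist_eq_norm, hw2]
        field_simp
        ring
      rw [hπw, hNG ⟨mem_image_of_mem H hw1.1, hw2⟩, hGH w hw1.1]
    · exact hN.comp_continuousOn (hπ.mono fun w hw => (hEcl hw).1)
  obtain ⟨w, hw⟩ := exists_eq_zero_of_eq_sub hF (a := x) (R := 1) fun w hw =>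
    piecewise_eq_of_notMem _ _ _ fun h => by
      have := mem_ball_zero_iff.1 (hEball w h)
      linarith
  by_cases hwE : w ∈ E
  · rw [piecewise_eq_of_mem _ _ _ hwE] at hw
    exact hN0 _ (hπs w hwE.1) hw
  · rw [piecewise_eq_of_notMem _ _ _ hwE, sub_eq_zero] at hw
    exact hwE ⟨hw ▸ ball_subset_closedBall hx, by simpa [hw] using hcx⟩

/-- A point on the boundary of an embedded disk can be cut off by a half-plane of the parameter
disk whose complement has small image. -/
theorem exists_halfPlane_of_notMem_image_ball {h : ℂ → ℂ} (hc : ContinuousOn h (closedBall 0 1))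
    (hinj : InjOn h (closedBall 0 1)) {r : ℂ} (hr : r ∉ h '' ball 0 1) {ε : ℝ} (hε : 0 < ε) :
    ∃ S : Set ℂ, IsClosed S ∧ Convex ℝ S ∧ (0 : ℂ) ∈ S ∧ r ∉ h '' (closedBall 0 1 ∩ S) ∧
      ∀ x ∈ closedBall (0 : ℂ) 1, x ∉ S → h x ∈ ball r ε := by
  by_cases hrD : r ∈ h '' closedBall 0 1
  swap
  · exact ⟨univ, isClosed_univ, convex_univ, trivial, by simpa using hrD, by simp⟩
  obtain ⟨s, hs, rfl⟩ := hrD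
  have hs1 : ‖s‖ = 1 := (mem_closedBall_zero_iff.1 hs).antisymm
    (not_lt.1 fun hlt => hr ⟨s, mem_ball_zero_iff.2 hlt, rfl⟩)
  obtain ⟨δ, hδ, hδh⟩ := Metric.continuousWithinAt_iff.1 (hc s hs) ε hε
  set η := min 1 (δ ^ 2 / 4)
  have hη : 0 < η := lt_min one_pos (by positivity)
  refine ⟨{x | inner ℝ s x ≤ 1 - η}, isClosed_le (by fun_prop) continuous_const,
    convex_halfSpace_le (innerₗ ℂ s).isLinear _, ?_, ?_, fun x hx hxS => ?_⟩
  · simp [η]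
  · rintro ⟨x, ⟨hx, hxS⟩, hxs⟩
    rw [hinj hx hs hxs, mem_ofPred_eq, real_inner_self_eq_norm_sq, hs1] at hxS
    linarith
  · refine hδh hx (lt_of_pow_lt_pow_left₀ 2 hδ.le ?_)
    rw [mem_ofPred_eq, not_le] at hxS
    rw [dist_comm, dist_eq_norm, norm_sub_sq_real, hs1]
    have h1 : ‖x‖ ^ 2 ≤ 1 := by
      have := mem_closedBall_zero_iff.1 hx
      nlinarith [norm_nonneg x]
    have h2 : η ≤ δ ^ 2 / 4 := min_le_right _ _
    nlinarith

theorem exists_isPreconnected_diff_balls {ι : Type*} [Finite ι] {h : ι → ℂ → ℂ}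
    (hc : ∀ i, ContinuousOn (h i) (closedBall 0 1)) (hinj : ∀ i, InjOn (h i) (closedBall 0 1))
    (hconn : IsConnected (⋃ i, interior (h i '' closedBall 0 1))) {p q : ℂ}
    (hp : p ∉ ⋃ i, interior (h i '' closedBall 0 1))
    (hq : q ∉ ⋃ i, interior (h i '' closedBall 0 1)) {ε : ℝ} (hε : 0 < ε) :
    ∃ δ > 0, ∃ T, IsPreconnected T ∧ T ⊆ (⋃ i, h i '' closedBall 0 1) \ (ball p δ ∪ ball q δ) ∧
      (⋃ i, h i '' closedBall 0 1) \ (ball p ε ∪ ball q ε) ⊆ T := by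
  set U := ⋃ i, interior (h i '' closedBall 0 1)
  have hball : ∀ i, h i '' ball 0 1 ⊆ U := fun i => image_subset_iff.2 fun x hx =>
    mem_iUnion.2 ⟨i, mem_interior_image_closedBall (hc i) (hinj i) hx⟩
  have hUV : U ⊆ ⋃ i, h i '' closedBall 0 1 := iUnion_mono fun i => interior_subset
  have hUp : IsPathConnected U :=
    (isOpen_iUnion fun i => isOpen_interior).isConnected_iff_isPathConnected.1 hconn
  obtain ⟨u, hu⟩ := hconn.nonempty
  have h0 : ∀ i, h i 0 ∈ U := fun i => hball i (mem_image_of_mem _ (mem_ball_self one_pos))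
  choose Sp hSpc hSpconv hSp0 hSpp hSpε using fun i =>
    exists_halfPlane_of_notMem_image_ball (hc i) (hinj i) (fun hr => hp (hball i hr)) hε
  choose Sq hSqc hSqconv hSq0 hSqq hSqε using fun i =>
    exists_halfPlane_of_notMem_image_ball (hc i) (hinj i) (fun hr => hq (hball i hr)) hε
  choose γ hγ using fun i => hUp.joinedIn u hu (h i 0) (h0 i)
  set D : ι → Set ℂ := fun i => closedBall 0 1 ∩ Sp i ∩ Sq i
  have hD : ∀ i, D i ⊆ closedBall 0 1 := fun i x hx => hx.1.1
  have hDcomp : ∀ i, IsCompact (D i) := fun i =>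
    ((isCompact_closedBall 0 1).inter_right (hSpc i)).inter_right (hSqc i)
  have hDconv : ∀ i, Convex ℝ (D i) := fun i =>
    ((convex_closedBall 0 1).inter (hSpconv i)).inter (hSqconv i)
  have hD0 : ∀ i, (0 : ℂ) ∈ D i := fun i => ⟨⟨by simp, hSp0 i⟩, hSq0 i⟩
  set T := ⋃ i, (range (γ i) ∪ h i '' D i)
  have hTcomp : IsCompact T := isCompact_iUnion fun i =>
    (isCompact_range (γ i).continuous).union ((hDcomp i).image_of_continuousOn ((hc i).mono (hD i)))
  have hTc : IsPreconnected T := by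
    refine isPreconnected_iUnion ⟨u, mem_iInter.2 fun i => Or.inl ⟨0, (γ i).source⟩⟩ fun i => ?_
    exact (isPreconnected_range (γ i).continuous).union (h i 0) ⟨1, (γ i).target⟩
      (mem_image_of_mem _ (hD0 i)) ((hDconv i).isPreconnected.image _ ((hc i).mono (hD i)))
  have hpT : p ∉ T := fun h => by
    obtain ⟨i, ⟨t, ht⟩ | ⟨x, hx, hxp⟩⟩ := mem_iUnion.1 h
    · exact hp (ht ▸ hγ i t)
    · exact hSpp i ⟨x, hx.1, hxp⟩
  have hqT : q ∉ T := fun h => by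
    obtain ⟨i, ⟨t, ht⟩ | ⟨x, hx, hxq⟩⟩ := mem_iUnion.1 h
    · exact hq (ht ▸ hγ i t)
    · exact hSqq i ⟨x, ⟨hx.1.1, hx.2⟩, hxq⟩
  obtain ⟨δ₁, hδ₁, hδp⟩ := Metric.isOpen_iff.1 hTcomp.isClosed.isOpen_compl p hpT
  obtain ⟨δ₂, hδ₂, hδq⟩ := Metric.isOpen_iff.1 hTcomp.isClosed.isOpen_compl q hqT
  refine ⟨min δ₁ δ₂, lt_min hδ₁ hδ₂, T, hTc, fun z hz => ⟨?_, ?_⟩, ?_⟩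
  · obtain ⟨i, ⟨t, ht⟩ | hx⟩ := mem_iUnion.1 hz
    · exact hUV (ht ▸ hγ i t)
    · exact mem_iUnion.2 ⟨i, image_mono (hD i) hx⟩
  · rintro (h | h)
    · exact hδp (ball_subset_ball (min_le_left _ _) h) hz
    · exact hδq (ball_subset_ball (min_le_right _ _) h) hz
  · rintro z ⟨hzV, hz⟩
    obtain ⟨i, x, hx, rfl⟩ := mem_iUnion.1 hzV
    refine mem_iUnion.2 ⟨i, Or.inr ⟨x, ⟨⟨hx, ?_⟩, ?_⟩, rfl⟩⟩
    · exact of_not_not fun hS => hz (Or.inl (hSpε i x hx hS))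
    · exact of_not_not fun hS => hz (Or.inr (hSqε i x hx hS))

theorem isPreconnected_compl_closedBall_zero (R : ℝ) (hR : 0 ≤ R) :
    IsPreconnected (closedBall (0 : ℂ) R)ᶜ := by
  have : (closedBall (0 : ℂ) R)ᶜ =
      (fun x : ℝ × ℝ => (x.1 : ℂ) * Complex.exp (x.2 * Complex.I)) '' (Ioi R ×ˢ univ) := by
    ext z
    simp only [mem_compl_iff, mem_closedBall_zero_iff, not_le, mem_image, mem_prod, mem_Ioi,
      mem_univ, and_true, Prod.exists]
    constructor
    · exact fun hz => ⟨‖z‖, z.arg, hz, Complex.norm_mul_exp_arg_mul_I z⟩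
    · rintro ⟨r, t, hr, rfl⟩
      simpa [Complex.norm_exp_ofReal_mul_I, abs_of_pos (hR.trans_lt hr)] using hr
  rw [this]
  exact (isPreconnected_Ioi.prod isPreconnected_univ).image _ (by fun_prop)

theorem frontier_connectedComponentIn_compl_subset_s9 {V : Set ℂ} (hV : IsClosed V) (x : ℂ) :
    frontier (connectedComponentIn Vᶜ x) ⊆ V := fun z hz => by
  by_contra hzV
  have hzV' : z ∈ Vᶜ := hzV
  obtain ⟨y, hyz, hyx⟩ := mem_closure_iff.1 (frontier_subset_closure hz) _
    (hV.isOpen_compl.connectedComponentIn (x := z)) (mem_connectedComponentIn hzV')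
  rw [(hV.isOpen_compl.connectedComponentIn).frontier_eq] at hz
  refine hz.2 ?_
  rw [connectedComponentIn_eq hyx, ← connectedComponentIn_eq hyz]
  exact mem_connectedComponentIn hzV'

theorem isBounded_connectedComponentIn_compl_of_ne {V : Set ℂ} (hV : Bornology.IsBounded V)
    {x y : ℂ} (hy : ¬ Bornology.IsBounded (connectedComponentIn Vᶜ y))
    (hxy : connectedComponentIn Vᶜ x ≠ connectedComponentIn Vᶜ y) :
    Bornology.IsBounded (connectedComponentIn Vᶜ x) := by
  by_contra hx
  obtain ⟨R, hR⟩ := hV.subset_closedBall 0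
  set R' := max R 0
  have hVR : V ⊆ closedBall 0 R' := hR.trans (closedBall_subset_closedBall (le_max_left _ _))
  have hfar : ∀ B : Set ℂ, ¬ Bornology.IsBounded B → ∃ z ∈ B, z ∈ (closedBall (0 : ℂ) R')ᶜ :=
    fun B hB => not_subset.1 fun hsub => hB (isBounded_closedBall.subset hsub)
  obtain ⟨z, hz, hzR⟩ := hfar _ hx
  obtain ⟨w, hw, hwR⟩ := hfar _ hy
  have := (isPreconnected_compl_closedBall_zero R' (le_max_right _ _)).subset_connectedComponentIn
    hzR (compl_subset_compl.2 hVR) hwR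
  exact hxy (by rw [connectedComponentIn_eq hz, connectedComponentIn_eq this,
    ← connectedComponentIn_eq hw])

theorem isConnected_interior_compl_unbounded_component {ι : Type*} [Finite ι] {h : ι → ℂ → ℂ}
    (hc : ∀ i, ContinuousOn (h i) (closedBall 0 1)) (hinj : ∀ i, InjOn (h i) (closedBall 0 1))
    (hconn : IsConnected (⋃ i, interior (h i '' closedBall 0 1))) {y : ℂ}
    (hy : y ∈ (⋃ i, h i '' closedBall 0 1)ᶜ)
    (hyb : ¬ Bornology.IsBounded (connectedComponentIn (⋃ i, h i '' closedBall 0 1)ᶜ y)) :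
    IsConnected (interior (connectedComponentIn (⋃ i, h i '' closedBall 0 1)ᶜ y)ᶜ) := by
  set V := ⋃ i, h i '' closedBall 0 1
  set U := ⋃ i, interior (h i '' closedBall 0 1)
  set W := connectedComponentIn Vᶜ y
  have hVc : IsCompact V := isCompact_iUnion fun i =>
    (isCompact_closedBall 0 1).image_of_continuousOn (hc i)
  have hWo : IsOpen W := hVc.isClosed.isOpen_compl.connectedComponentIn
  have hWV : W ⊆ Vᶜ := connectedComponentIn_subset _ _
  have hUo : IsOpen U := isOpen_iUnion fun i => isOpen_interior
  have hUV : U ⊆ V := iUnion_mono fun i => interior_subset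
  have hVU : V ⊆ closure U := iUnion_subset fun i => by
    rw [← closure_ball (0 : ℂ) one_ne_zero]
    refine ((hc i).mono (closure_ball (0 : ℂ) one_ne_zero).le).image_closure.trans
      (closure_mono (image_subset_iff.2 fun x hx => mem_iUnion.2 ⟨i, ?_⟩))
    exact mem_interior_image_closedBall (hc i) (hinj i) hx
  have hUI : U ⊆ interior Wᶜ :=
    interior_maximal (hUV.trans (subset_compl_comm.1 hWV)) hUo
  have hUW : Disjoint U (closure W) :=
    (disjoint_compl_right_iff_subset.2 hUI).mono_right (by rw [interior_compl, compl_compl])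
  have key : ∀ x, x ∈ Vᶜ → connectedComponentIn Vᶜ x ≠ W →
      ¬ frontier (connectedComponentIn Vᶜ x) ⊆ closure W := by
    intro x hx hxW hsub
    set B := connectedComponentIn Vᶜ x
    have hBo : IsOpen B := hVc.isClosed.isOpen_compl.connectedComponentIn
    have hBV : frontier B ⊆ V := frontier_connectedComponentIn_compl_subset_s9 hVc.isClosed x
    have hBb : Bornology.IsBounded B :=
      isBounded_connectedComponentIn_compl_of_ne hVc.isBounded hyb hxW
    have hdisj : Disjoint W B := disjoint_left.2 fun z hzW hzB =>
      hxW ((connectedComponentIn_eq hzB).trans (connectedComponentIn_eq hzW).symm)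
    have hxB : x ∈ B := mem_connectedComponentIn hx
    have hyW : y ∈ W := mem_connectedComponentIn hy
    have hyB : y ∉ closure B := disjoint_left.1 (hdisj.closure_right hWo) hyW
    have hno := not_exists_exp_eq_div_on_frontier hBb hxB hyB
    have hnt : (frontier B).Nontrivial := by
      by_contra hs
      rw [not_nontrivial_iff] at hs
      refine hno ⟨fun z => Complex.log ((z - x) / (z - y)), hs.continuousOn _, fun z hz =>
        Complex.exp_log (div_ne_zero (sub_ne_zero.2 fun h => hx (hBV (h ▸ hz)))
          (sub_ne_zero.2 fun h => hy (hBV (h ▸ hz))))⟩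
    obtain ⟨p, hp, q, hq, hpq⟩ := hnt
    have hU : ∀ r ∈ frontier B, r ∉ U := fun r hr hrU => disjoint_left.1 hUW hrU (hsub hr)
    obtain ⟨ℓ, hℓ, hℓe⟩ := exists_continuousOn_exp_eq_div_of_two_points hVc.isClosed
      isPreconnected_connectedComponentIn isPreconnected_connectedComponentIn
      (disjoint_left.2 (connectedComponentIn_subset _ _)) (disjoint_left.2 hWV) hxB hyW
      (frontier_subset_closure hp) (hsub hp) (frontier_subset_closure hq) (hsub hq) hpq
      fun ε hε => exists_isPreconnected_diff_balls hc hinj hconn (hU p hp) (hU q hq) hε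
    exact hno ⟨ℓ, hℓ.mono hBV, fun z hz => hℓe z (hBV hz)⟩
  have hjoin : ∀ z ∈ V, z ∈ interior Wᶜ →
      ∃ r > 0, ball z r ⊆ interior Wᶜ ∧ IsPreconnected (ball z r ∪ U) := fun z hz hzI => by
    obtain ⟨r, hr, hrI⟩ := Metric.isOpen_iff.1 isOpen_interior z hzI
    exact ⟨r, hr, hrI, (convex_ball z r).isPreconnected.union'
      (mem_closure_iff.1 (hVU hz) _ isOpen_ball (mem_ball_self hr)) hconn.isPreconnected⟩
  obtain ⟨u, hu⟩ := hconn.nonempty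
  refine ⟨⟨u, hUI hu⟩, isPreconnected_of_forall u fun x hx => ?_⟩
  by_cases hxV : x ∈ V
  · obtain ⟨r, hr, hrI, hpre⟩ := hjoin x hxV hx
    exact ⟨_, union_subset hrI hUI, Or.inr hu, Or.inl (mem_ball_self hr), hpre⟩
  · have hxB : x ∈ connectedComponentIn Vᶜ x := mem_connectedComponentIn hxV
    have hxW : connectedComponentIn Vᶜ x ≠ W := fun h => interior_subset hx (h ▸ hxB)
    obtain ⟨p, hp, hpW⟩ := not_subset.1 (key x hxV hxW)
    obtain ⟨r, hr, hrI, hpre⟩ := hjoin p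
      (frontier_connectedComponentIn_compl_subset_s9 hVc.isClosed x hp) (by rwa [interior_compl])
    have hBI : connectedComponentIn Vᶜ x ⊆ interior Wᶜ :=
      interior_maximal (fun z hzB hzW =>
        hxW ((connectedComponentIn_eq hzB).trans (connectedComponentIn_eq hzW).symm))
        hVc.isClosed.isOpen_compl.connectedComponentIn
    refine ⟨connectedComponentIn Vᶜ x ∪ (ball p r ∪ U), union_subset hBI (union_subset hrI hUI),
      Or.inr (Or.inr hu), Or.inl hxB, isPreconnected_connectedComponentIn.union' ?_ hpre⟩
    exact (mem_closure_iff.1 (frontier_subset_closure hp) _ isOpen_ball (mem_ball_self hr)).mono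
      fun z hz => ⟨hz.2, Or.inl hz.1⟩

/-- A homeomorphic copy of the closed disk in the plane, parametrized by the complex unit disk. -/
theorem exists_complex_parametrization (e : Plane ≃ₗᵢ[ℝ] ℂ) {V : Set Plane}
    (φ : V ≃ₜ closedBall (0 : Plane) 1) :
    ∃ h : ℂ → ℂ, ContinuousOn h (closedBall 0 1) ∧ InjOn h (closedBall 0 1) ∧
      h '' closedBall 0 1 = e '' V := by
  have hmem : ∀ w : closedBall (0 : ℂ) 1, e.symm w.1 ∈ closedBall (0 : Plane) 1 := fun w => by
    simpa using mem_closedBall_zero_iff.1 w.2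
  let k : closedBall (0 : ℂ) 1 → ℂ := fun w => e (φ.symm ⟨e.symm w.1, hmem w⟩)
  have hk : Continuous k := e.continuous.comp (continuous_subtype_val.comp
    (φ.symm.continuous.comp ((e.symm.continuous.comp continuous_subtype_val).subtype_mk hmem)))
  have hkinj : Function.Injective k := fun w w' hww => by
    have := φ.symm.injective (Subtype.ext (e.injective hww))
    exact Subtype.ext (e.symm.injective (congrArg Subtype.val this))
  obtain ⟨g, hg⟩ := ContinuousMap.exists_restrict_eq (isClosed_closedBall (x := (0 : ℂ)) (ε := 1))
    ⟨k, hk⟩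
  have hgk : ∀ w : closedBall (0 : ℂ) 1, g w = k w := fun w => congr($hg w)
  refine ⟨g, g.continuous.continuousOn, fun w hw w' hw' hww => ?_, Subset.antisymm ?_ ?_⟩
  · have := hkinj (((hgk ⟨w, hw⟩).symm.trans hww).trans (hgk ⟨w', hw'⟩))
    exact congrArg Subtype.val this
  · rintro _ ⟨w, hw, rfl⟩
    exact ⟨_, (φ.symm ⟨e.symm w, hmem ⟨w, hw⟩⟩).2, (hgk ⟨w, hw⟩).symm⟩
  · rintro _ ⟨v, hv, rfl⟩
    have hw : e (φ ⟨v, hv⟩) ∈ closedBall (0 : ℂ) 1 := by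
      simpa using mem_closedBall_zero_iff.1 (φ ⟨v, hv⟩).2
    refine ⟨_, hw, (hgk ⟨_, hw⟩).trans ?_⟩
    simp [k]

theorem stmt_9 (n : ℕ) (V : Fin n → Set Plane)
    (hclosed : ∀ i, IsClosed (V i))
    (hdisk : ∀ i, Nonempty ((V i) ≃ₜ (closedBall (0 : Plane) 1)))
    (hconn : IsConnected (⋃ i, interior (V i)))
    (W : Set Plane)
    (hWcomp : ∃ x ∈ (⋃ i, V i)ᶜ, W = connectedComponentIn (⋃ i, V i)ᶜ x)
    (hWunbounded : ¬ Bornology.IsBounded W) :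
    IsConnected (interior (Wᶜ : Set Plane)) := by
  obtain ⟨x, hx, rfl⟩ := hWcomp
  let e : Plane ≃ₗᵢ[ℝ] ℂ := Complex.orthonormalBasisOneI.repr.symm
  let E : Plane ≃ₜ ℂ := e.toHomeomorph
  choose h hc hinj hV using fun i => exists_complex_parametrization e (hdisk i).some
  have hEV : ∀ i, h i '' closedBall 0 1 = E '' V i := hV
  have hU : ⋃ i, interior (h i '' closedBall 0 1) = E '' ⋃ i, interior (V i) := by
    simp_rw [hEV, ← E.image_interior, image_iUnion]
  have hVc : (⋃ i, h i '' closedBall 0 1)ᶜ = E '' (⋃ i, V i)ᶜ := by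
    simp_rw [hEV, ← image_iUnion, image_compl_eq E.bijective]
  have hW : connectedComponentIn (⋃ i, h i '' closedBall 0 1)ᶜ (E x) =
      E '' connectedComponentIn (⋃ i, V i)ᶜ x := by
    rw [hVc, E.image_connectedComponentIn hx]
  have key := isConnected_interior_compl_unbounded_component hc hinj (y := E x)
    (by rw [hU]; exact hconn.image _ E.continuous.continuousOn)
    (by rw [hVc]; exact mem_image_of_mem _ hx)
    (by
      rw [hW]
      intro hb
      refine hWunbounded ((e.symm.lipschitz.isBounded_image hb).subset fun z hz => ?_)
      exact ⟨e z, ⟨z, hz, rfl⟩, e.symm_apply_apply z⟩)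
  rw [hW, ← image_compl_eq E.bijective, ← E.image_interior] at key
  have := key.image E.symm E.symm.continuous.continuousOn
  rwa [← image_comp, E.symm_comp_self, image_id] at this
end

section
/- Let V₁, …, Vₙ be finitely many closed subsets of ℝ², each homeomorphic to the closed disk, with ⋃ᵢ int Vᵢ connected. Let W be the unbounded component of ℝ² \ ⋃ᵢ Vᵢ and let W̃ be any other (bounded) connected component of ℝ² \ ⋃ᵢ Vᵢ. Then ∂W̃ ∩ ∂W contains at most two points. -/
open Metric Set

/-- The function `f` has a continuous logarithm on the set `s`. -/
def HasLogOn (f : ℂ → ℂ) (s : Set ℂ) : Prop :=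
  ∃ g : ℂ → ℂ, ContinuousOn g s ∧ ∀ z ∈ s, Complex.exp (g z) = f z

namespace HasLogOn

variable {f f₁ f₂ : ℂ → ℂ} {s t : Set ℂ}

theorem mono (h : HasLogOn f t) (hst : s ⊆ t) : HasLogOn f s := by
  obtain ⟨g, hg, hgf⟩ := h
  exact ⟨g, hg.mono hst, fun z hz => hgf z (hst hz)⟩

theorem congr (h : HasLogOn f₁ s) (h' : EqOn f₁ f₂ s) : HasLogOn f₂ s := by
  obtain ⟨g, hg, hgf⟩ := h
  exact ⟨g, hg, fun z hz => (hgf z hz).trans (h' hz)⟩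

theorem mul (h₁ : HasLogOn f₁ s) (h₂ : HasLogOn f₂ s) : HasLogOn (fun z => f₁ z * f₂ z) s := by
  obtain ⟨g₁, hg₁, hf₁⟩ := h₁
  obtain ⟨g₂, hg₂, hf₂⟩ := h₂
  exact ⟨fun z => g₁ z + g₂ z, hg₁.add hg₂, fun z hz => by
    rw [Complex.exp_add, hf₁ z hz, hf₂ z hz]⟩

theorem inv (h : HasLogOn f s) : HasLogOn (fun z => (f z)⁻¹) s := by
  obtain ⟨g, hg, hgf⟩ := h
  exact ⟨fun z => -g z, hg.neg, fun z hz => by rw [Complex.exp_neg, hgf z hz]⟩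

theorem of_mem_slitPlane (hf : ContinuousOn f s) (h : ∀ z ∈ s, f z ∈ Complex.slitPlane) :
    HasLogOn f s :=
  ⟨fun z => Complex.log (f z), hf.clog h,
    fun z hz => Complex.exp_log (Complex.slitPlane_ne_zero (h z hz))⟩

theorem of_norm_sub_one_lt (hf : ContinuousOn f s) (h : ∀ z ∈ s, ‖f z - 1‖ < 1) :
    HasLogOn f s :=
  of_mem_slitPlane hf fun z hz => by
    have := Complex.mem_slitPlane_of_norm_lt_one (h z hz)
    simpa using this

theorem comp {φ : ℂ → ℂ} (h : HasLogOn f t) (hφ : ContinuousOn φ s) (hst : MapsTo φ s t) :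
    HasLogOn (fun z => f (φ z)) s := by
  obtain ⟨g, hg, hgf⟩ := h
  exact ⟨g ∘ φ, hg.comp hφ hst, fun z hz => hgf _ (hst hz)⟩

end HasLogOn

/-- The radial retraction of the plane onto the closed unit disk. -/
noncomputable def diskRetraction (z : ℂ) : ℂ := (max 1 ‖z‖)⁻¹ • z

theorem continuous_diskRetraction : Continuous diskRetraction := by
  unfold diskRetraction
  have hc : Continuous fun z : ℂ => max 1 ‖z‖ := by fun_prop
  refine (hc.inv₀ fun z => ?_).smul continuous_id
  have := le_max_left 1 ‖z‖
  positivity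

theorem diskRetraction_mem (z : ℂ) : diskRetraction z ∈ closedBall (0 : ℂ) 1 := by
  have h1 : (0 : ℝ) < max 1 ‖z‖ := lt_of_lt_of_le one_pos (le_max_left _ _)
  rw [mem_closedBall_zero_iff, diskRetraction, norm_smul, norm_inv, Real.norm_of_nonneg h1.le,
    inv_mul_le_iff₀ h1]
  simp

theorem diskRetraction_eq {z : ℂ} (hz : z ∈ closedBall (0 : ℂ) 1) : diskRetraction z = z := by
  rw [mem_closedBall_zero_iff] at hz
  simp [diskRetraction, max_eq_left hz]

theorem hasLogOn_unitDisk {f : ℂ → ℂ} (hf : ContinuousOn f (closedBall 0 1))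
    (h0 : ∀ z ∈ closedBall (0 : ℂ) 1, f z ≠ 0) : HasLogOn f (closedBall 0 1) := by
  have hc : Continuous (f ∘ diskRetraction) :=
    hf.comp_continuous continuous_diskRetraction diskRetraction_mem
  have hsc : IsSimplyConnected (univ : Set ℂ) := by
    have := (convex_univ (𝕜 := ℝ) (E := ℂ)).contractibleSpace univ_nonempty
    exact SimplyConnectedSpace.ofContractible _
  obtain ⟨g, hg, hgf⟩ := Complex.exists_continuousOn_eqOn_exp_comp hsc isOpen_univ
    hc.continuousOn (by rintro ⟨z, -, hz⟩; exact h0 _ (diskRetraction_mem z) hz)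
  refine ⟨g, hg.mono (subset_univ _), fun z hz => ?_⟩
  have := hgf (mem_univ z)
  simpa [diskRetraction_eq hz] using this

theorem hasLogOn_closedBall {f : ℂ → ℂ} {a : ℂ} {r : ℝ} (hr : 0 < r)
    (hf : ContinuousOn f (closedBall a r)) (h0 : ∀ z ∈ closedBall a r, f z ≠ 0) :
    HasLogOn f (closedBall a r) := by
  have hm : MapsTo (fun z : ℂ => a + r * z) (closedBall 0 1) (closedBall a r) := by
    intro z hz
    rw [mem_closedBall_zero_iff] at hz
    simp only [mem_closedBall, dist_eq_norm, add_sub_cancel_left, norm_mul, Complex.norm_real,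
      Real.norm_of_nonneg hr.le]
    nlinarith
  have hm' : MapsTo (fun z : ℂ => (z - a) / r) (closedBall a r) (closedBall 0 1) := by
    intro z hz
    rw [mem_closedBall, dist_eq_norm] at hz
    rw [mem_closedBall_zero_iff, norm_div, Complex.norm_real, Real.norm_of_nonneg hr.le,
      div_le_one hr]
    exact hz
  have h1 := hasLogOn_unitDisk (f := fun z => f (a + r * z))
    (hf.comp (by fun_prop) hm) fun z hz => h0 _ (hm hz)
  refine (h1.comp (φ := fun z => (z - a) / r) (by fun_prop) hm').congr fun z _ => ?_
  have : (r : ℂ) ≠ 0 := by exact_mod_cast hr.ne'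
  simp only
  congr 1
  field_simp
  ring

theorem exists_int_of_exp_eq {X : Type*} [TopologicalSpace X] {s : Set X} (hs : IsPreconnected s)
    {g₁ g₂ : X → ℂ} (h₁ : ContinuousOn g₁ s) (h₂ : ContinuousOn g₂ s)
    (h : ∀ x ∈ s, Complex.exp (g₁ x) = Complex.exp (g₂ x)) :
    ∃ n : ℤ, ∀ x ∈ s, g₁ x = g₂ x + n * (2 * Real.pi * Complex.I) := by
  rcases s.eq_empty_or_nonempty with rfl | ⟨x₀, hx₀⟩
  · exact ⟨0, by simp⟩
  have hn : ∀ x ∈ s, ∃ n : ℤ, g₁ x = g₂ x + n * (2 * Real.pi * Complex.I) := fun x hx =>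
    Complex.exp_eq_exp_iff_exists_int.1 (h x hx)
  have key : ∀ (x : X) (n : ℤ), g₁ x = g₂ x + n * (2 * Real.pi * Complex.I) →
      (g₁ x - g₂ x).im / (2 * Real.pi) = n := by
    intro x n hx
    rw [hx]
    simp [Real.pi_pos.ne']
  have hpre : IsPreconnected ((fun x => (g₁ x - g₂ x).im / (2 * Real.pi)) '' s) :=
    hs.image _ ((Complex.continuous_im.comp_continuousOn (h₁.sub h₂)).div_const _)
  obtain ⟨n, hn₀⟩ := hn x₀ hx₀
  refine ⟨n, fun x hx => ?_⟩
  obtain ⟨m, hm⟩ := hn x hx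
  have hlt : ∀ a b : ℤ, ((a : ℝ) ∈ ((fun x => (g₁ x - g₂ x).im / (2 * Real.pi)) '' s)) →
      ((b : ℝ) ∈ ((fun x => (g₁ x - g₂ x).im / (2 * Real.pi)) '' s)) → ¬ a < b := by
    intro a b ha hb hab
    have hab' : (a : ℝ) + 1 ≤ b := by exact_mod_cast hab
    obtain ⟨y, hy, hya⟩ := hpre.ordConnected.out ha hb
      (show (a : ℝ) + 1 / 2 ∈ Icc (a : ℝ) b by constructor <;> linarith)
    obtain ⟨k, hk⟩ := hn y hy
    have h3 : (k : ℝ) = a + 1 / 2 := (key y k hk).symm.trans hya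
    have h4 : (2 * k : ℤ) = 2 * a + 1 := by
      have : (2 * k : ℝ) = 2 * a + 1 := by linarith
      exact_mod_cast this
    omega
  have e1 := hlt n m ⟨x₀, hx₀, key _ _ hn₀⟩ ⟨x, hx, key _ _ hm⟩
  have e2 := hlt m n ⟨x, hx, key _ _ hm⟩ ⟨x₀, hx₀, key _ _ hn₀⟩
  have : m = n := by omega
  rwa [this] at hm

theorem not_hasLogOn_sphere (a : ℂ) {r : ℝ} (hr : 0 < r) :
    ¬ HasLogOn (fun z => z - a) (sphere a r) := by
  rintro ⟨g, hg, hgf⟩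
  have hr' : (r : ℂ) ≠ 0 := by exact_mod_cast hr.ne'
  have hm : ∀ t : ℝ, circleMap a r t ∈ sphere a r := circleMap_mem_sphere a hr.le
  obtain ⟨n, hn⟩ := exists_int_of_exp_eq (s := (univ : Set ℝ)) isPreconnected_univ
    (g₁ := fun t => g (circleMap a r t)) (g₂ := fun t : ℝ => Complex.log r + t * Complex.I)
    (hg.comp (continuous_circleMap a r).continuousOn fun t _ => hm t) (by fun_prop)
    (fun t _ => by
      rw [hgf _ (hm t), Complex.exp_add, Complex.exp_log hr']
      simp [circleMap])
  have h0 := hn 0 trivial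
  have h1 := hn (2 * Real.pi) trivial
  have h2 : circleMap a r (2 * Real.pi) = circleMap a r 0 := by simp [circleMap]
  rw [h2, h0] at h1
  have h3 : (2 * Real.pi * Complex.I : ℂ) = 0 := by
    push_cast at h1
    linear_combination -h1
  exact Complex.two_pi_I_ne_zero h3

theorem exists_zero_of_norm_sub_lt {F : ℂ → ℂ} {a : ℂ} {r : ℝ} (hr : 0 < r)
    (hF : ContinuousOn F (closedBall a r))
    (h : ∀ z ∈ sphere a r, ‖F z - (z - a)‖ < r) : ∃ z ∈ closedBall a r, F z = 0 := by
  by_contra! h0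
  have hne : ∀ z ∈ sphere a r, z - a ≠ 0 := by
    intro z hz hza
    rw [mem_sphere, dist_eq_norm, hza, norm_zero] at hz
    exact hr.ne hz
  have h1 : HasLogOn F (sphere a r) := (hasLogOn_closedBall hr hF h0).mono sphere_subset_closedBall
  have h2 : HasLogOn (fun z => F z / (z - a)) (sphere a r) := by
    refine HasLogOn.of_norm_sub_one_lt
      ((hF.mono sphere_subset_closedBall).div (by fun_prop) hne) fun z hz => ?_
    have h3 := h z hz
    rw [div_sub_one (hne z hz), norm_div, div_lt_one (norm_pos_iff.2 (hne z hz))]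
    rw [mem_sphere, dist_eq_norm] at hz
    rwa [hz]
  refine not_hasLogOn_sphere a hr ((h1.mul h2.inv).congr fun z hz => ?_)
  have := h0 z (sphere_subset_closedBall hz)
  have := hne z hz
  simp only
  field_simp

theorem exists_continuous_approx_ne_zero_on_sphere {G : ℂ → ℂ} (hG : Continuous G) {δ : ℝ}
    (hδ : 0 < δ) (c : ℂ) (ε : ℝ) :
    ∃ P : ℂ → ℂ, Continuous P ∧ (∀ z, ‖P z - G z‖ < δ) ∧ ∀ z ∈ sphere c ε, P z ≠ 0 := by
  obtain ⟨P, hP, hPG, -⟩ := hG.exists_contDiff_approx (ε := fun _ => δ / 2) 1 continuous_const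
    fun _ => half_pos hδ
  have h0 : MeasureTheory.volume (P '' sphere c ε) = 0 :=
    MeasureTheory.addHaar_image_eq_zero_of_differentiableOn_of_addHaar_eq_zero _
      (hP.differentiable (by simp)).differentiableOn
      (MeasureTheory.Measure.addHaar_sphere _ c ε)
  obtain ⟨v, hv, hvP⟩ : ∃ v ∈ ball (0 : ℂ) (δ / 2), v ∉ P '' sphere c ε := by
    by_contra! h
    have h1 := MeasureTheory.measure_mono_null (μ := MeasureTheory.volume) h h0
    exact (measure_ball_pos MeasureTheory.volume (0 : ℂ) (half_pos hδ)).ne' h1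
  refine ⟨fun z => P z - v, hP.continuous.sub continuous_const, fun z => ?_, fun z hz h => ?_⟩
  · have h1 := hPG z
    rw [dist_eq_norm] at h1
    rw [mem_ball_zero_iff] at hv
    calc ‖P z - v - G z‖ = ‖(P z - G z) - v‖ := by ring_nf
      _ ≤ ‖P z - G z‖ + ‖v‖ := norm_sub_le _ _
      _ < δ := by linarith
  · exact hvP ⟨z, hz, sub_eq_zero.1 h⟩

/-- Invariance of domain in the plane: an embedding of a closed disk, with inverse extended to a
continuous map `G` of the plane, maps the centre to an interior point of the image. -/
theorem mem_interior_image_closedBall_s10 {φ G : ℂ → ℂ} {a : ℂ} {r : ℝ} (hr : 0 < r)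
    (hφ : ContinuousOn φ (closedBall a r)) (hG : Continuous G)
    (hGφ : ∀ z ∈ closedBall a r, G (φ z) = z - a) : φ a ∈ interior (φ '' closedBall a r) := by
  by_contra hint
  set H := φ '' closedBall a r with hH
  have hHc : IsCompact H := (isCompact_closedBall a r).image_of_continuousOn hφ
  have hGa : G (φ a) = 0 := by rw [hGφ a (mem_closedBall_self hr.le), sub_self]
  obtain ⟨ε, hε, hεG⟩ := Metric.continuous_iff.1 hG (φ a) (r / 4) (by positivity)
  simp only [hGa, dist_zero_right] at hεG
  obtain ⟨c, hcH, hc⟩ : ∃ c, c ∉ H ∧ dist c (φ a) < ε / 2 := by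
    by_contra! h
    refine hint (mem_interior_iff_mem_nhds.2 (Metric.mem_nhds_iff.2 ⟨ε / 2, by positivity, ?_⟩))
    intro z hz
    by_contra hzH
    exact absurd (h z hzH) (not_le.2 hz)
  obtain ⟨δ, hδ, hδr, hδG⟩ : ∃ δ > 0, δ ≤ r / 2 ∧ ∀ y ∈ H, ε / 2 ≤ dist y c → δ ≤ ‖G y‖ := by
    have hSc : IsCompact (H ∩ {y | ε / 2 ≤ dist y c}) :=
      hHc.inter_right (isClosed_le continuous_const (by fun_prop))
    rcases (H ∩ {y | ε / 2 ≤ dist y c}).eq_empty_or_nonempty with he | hne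
    · refine ⟨r / 2, by positivity, le_rfl, fun y hy hyc => ?_⟩
      exact absurd (show y ∈ H ∩ {y | ε / 2 ≤ dist y c} from ⟨hy, hyc⟩) (by simp [he])
    · obtain ⟨y₀, ⟨⟨x₀, hx₀, rfl⟩, hy₀c⟩, hmin⟩ := hSc.exists_isMinOn hne hG.norm.continuousOn
      refine ⟨min (r / 2) ‖G (φ x₀)‖, lt_min (by positivity) ?_, min_le_left _ _,
        fun y hy hyc => (min_le_right _ _).trans (hmin ⟨hy, hyc⟩)⟩
      rw [norm_pos_iff, hGφ x₀ hx₀, sub_ne_zero]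
      rintro rfl
      rw [mem_ofPred_eq, dist_comm] at hy₀c
      linarith
  obtain ⟨P, hP, hPG, hP0⟩ := exists_continuous_approx_ne_zero_on_sphere hG hδ c (ε / 2)
  set Φ : ℂ → ℂ := fun y => c + (max (ε / 2 / ‖y - c‖) 1) • (y - c) with hΦ
  have hΦc : ContinuousOn Φ H := by
    have h1 : ContinuousOn (fun y : ℂ => ε / 2 / ‖y - c‖) H :=
      continuousOn_const.div (by fun_prop) fun y hy => by
        rw [norm_ne_zero_iff, sub_ne_zero]
        rintro rfl
        exact hcH hy
    exact continuousOn_const.add ((h1.sup continuousOn_const).smul (by fun_prop))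
  have hΦfar : ∀ y ∈ H, ε / 2 ≤ dist y c → Φ y = y := by
    intro y hy hyc
    rw [dist_eq_norm] at hyc
    have h1 : ε / 2 / ‖y - c‖ ≤ 1 := div_le_one_of_le₀ hyc (norm_nonneg _)
    simp [hΦ, max_eq_right h1]
  have hΦnear : ∀ y ∈ H, dist y c < ε / 2 → Φ y ∈ sphere c (ε / 2) := by
    intro y hy hyc
    have h0 : 0 < ‖y - c‖ := by
      rw [norm_pos_iff, sub_ne_zero]
      rintro rfl
      exact hcH hy
    rw [dist_eq_norm] at hyc
    have h1 : 1 ≤ ε / 2 / ‖y - c‖ := (one_le_div h0).2 hyc.le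
    rw [mem_sphere, dist_eq_norm, hΦ]
    simp only [max_eq_left h1, add_sub_cancel_left, norm_smul]
    rw [Real.norm_of_nonneg (by positivity)]
    field_simp
  obtain ⟨z, hz, hz0⟩ := exists_zero_of_norm_sub_lt (F := fun z => P (Φ (φ z))) hr
    (hP.comp_continuousOn (hΦc.comp hφ fun z hz => mem_image_of_mem φ hz)) (fun z hz => by
      have hz' := sphere_subset_closedBall hz
      have hy : φ z ∈ H := mem_image_of_mem φ hz'
      rw [← hGφ z hz']
      rcases le_or_gt (ε / 2) (dist (φ z) c) with h | h
      · rw [hΦfar _ hy h]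
        linarith [hPG (φ z)]
      · have h1 := hΦnear _ hy h
        rw [mem_sphere] at h1
        have h2 := hεG (φ z) (by linarith [dist_triangle (φ z) c (φ a)])
        have h3 := hεG (Φ (φ z)) (by linarith [dist_triangle (Φ (φ z)) c (φ a)])
        have h4 := hPG (Φ (φ z))
        calc ‖P (Φ (φ z)) - G (φ z)‖
            = ‖(P (Φ (φ z)) - G (Φ (φ z))) + G (Φ (φ z)) - G (φ z)‖ := by ring_nf
          _ ≤ ‖P (Φ (φ z)) - G (Φ (φ z))‖ + ‖G (Φ (φ z))‖ + ‖G (φ z)‖ :=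
            (norm_sub_le _ _).trans (add_le_add_left (norm_add_le _ _) _)
          _ < r := by linarith)
  have hy : φ z ∈ H := mem_image_of_mem φ hz
  rcases le_or_gt (ε / 2) (dist (φ z) c) with h | h
  · have h1 := hPG (φ z)
    simp only [hΦfar _ hy h] at hz0
    rw [hz0, zero_sub, norm_neg] at h1
    exact absurd (hδG _ hy h) (not_le.2 h1)
  · exact hP0 _ (hΦnear _ hy h) hz0

/-- A set homeomorphic to the closed unit disk, with the homeomorphism and its inverse extended
to continuous maps of the plane. -/
def IsTopologicalDisk (V : Set ℂ) : Prop :=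
  ∃ φ ψ : ℂ → ℂ, Continuous φ ∧ Continuous ψ ∧
    (∀ z ∈ closedBall (0 : ℂ) 1, ψ (φ z) = z) ∧ φ '' closedBall 0 1 = V

namespace IsTopologicalDisk

variable {V : Set ℂ}

theorem of_homeomorph (hV : IsClosed V) (e : V ≃ₜ closedBall (0 : ℂ) 1) : IsTopologicalDisk V := by
  obtain ⟨ψ, hψ⟩ := ContinuousMap.exists_restrict_eq hV
    (⟨fun v => (e v : ℂ), by fun_prop⟩ : C(V, ℂ))
  have hψe : ∀ v : V, ψ v = e v := fun v => DFunLike.congr_fun hψ v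
  refine ⟨fun z => e.symm ⟨diskRetraction z, diskRetraction_mem z⟩, ψ, ?_, ψ.continuous, ?_, ?_⟩
  · exact continuous_subtype_val.comp
      (e.symm.continuous.comp (continuous_diskRetraction.subtype_mk _))
  · intro z hz
    simp [hψe, diskRetraction_eq hz]
  · ext v
    constructor
    · rintro ⟨z, -, rfl⟩
      exact Subtype.coe_prop _
    · intro hv
      refine ⟨e ⟨v, hv⟩, (e ⟨v, hv⟩).2, ?_⟩
      simp [diskRetraction_eq (e ⟨v, hv⟩).2]

theorem isCompact (hV : IsTopologicalDisk V) : IsCompact V := by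
  obtain ⟨φ, ψ, hφ, -, -, rfl⟩ := hV
  exact (isCompact_closedBall 0 1).image hφ

theorem hasLogOn (hV : IsTopologicalDisk V) {f : ℂ → ℂ} (hf : ContinuousOn f V)
    (h0 : ∀ z ∈ V, f z ≠ 0) : HasLogOn f V := by
  obtain ⟨φ, ψ, hφ, hψ, hψφ, rfl⟩ := hV
  have h1 : HasLogOn (fun z => f (φ z)) (closedBall 0 1) :=
    hasLogOn_unitDisk (hf.comp hφ.continuousOn (mapsTo_image _ _))
      fun z hz => h0 _ (mem_image_of_mem φ hz)
  refine (h1.comp (φ := ψ) hψ.continuousOn ?_).congr ?_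
  · rintro _ ⟨z, hz, rfl⟩
    rwa [hψφ z hz]
  · rintro _ ⟨z, hz, rfl⟩
    simp only [hψφ z hz]

theorem image_ball_subset_interior {φ ψ : ℂ → ℂ} (hφ : Continuous φ) (hψ : Continuous ψ)
    (hψφ : ∀ z ∈ closedBall (0 : ℂ) 1, ψ (φ z) = z) :
    φ '' ball 0 1 ⊆ interior (φ '' closedBall 0 1) := by
  rintro _ ⟨a, ha, rfl⟩
  rw [mem_ball_zero_iff] at ha
  have hsub : closedBall a (1 - ‖a‖) ⊆ closedBall 0 1 :=
    closedBall_subset_closedBall' (by simp)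
  exact interior_mono (image_mono hsub) <|
    mem_interior_image_closedBall_s10 (G := fun z => ψ z - a) (by linarith) hφ.continuousOn
      (by fun_prop) fun z hz => by rw [hψφ z (hsub hz)]

theorem interior_nonempty (hV : IsTopologicalDisk V) : (interior V).Nonempty := by
  obtain ⟨φ, ψ, hφ, hψ, hψφ, rfl⟩ := hV
  exact ⟨φ 0, image_ball_subset_interior hφ hψ hψφ (mem_image_of_mem φ (mem_ball_self one_pos))⟩

theorem isPathConnected_diff_singleton (hV : IsTopologicalDisk V) {p : ℂ} (hp : p ∉ interior V) :
    IsPathConnected (V \ {p}) := by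
  obtain ⟨φ, ψ, hφ, hψ, hψφ, rfl⟩ := hV
  have hint := image_ball_subset_interior hφ hψ hψφ
  have heq : φ '' closedBall 0 1 \ {p} = φ '' (closedBall 0 1 \ φ ⁻¹' {p}) := by
    rw [image_sdiff_preimage]
  rw [heq]
  have hball : ball (0 : ℂ) 1 ⊆ closedBall 0 1 \ φ ⁻¹' {p} := fun z hz =>
    ⟨ball_subset_closedBall hz, fun h => hp (hint ⟨z, hz, h⟩)⟩
  refine IsPathConnected.image (Convex.isPathConnected ?_ ⟨0, hball (mem_ball_self one_pos)⟩) hφ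
  rw [convex_iff_openSegment_subset]
  intro x hx y hy
  rcases eq_or_ne x y with rfl | hxy
  · simpa using hx
  · refine Subset.trans ?_ hball
    have := (strictConvex_closedBall ℝ (0 : ℂ) 1).openSegment_subset hx.1 hy.1 hxy
    rwa [interior_closedBall _ one_ne_zero] at this

end IsTopologicalDisk

theorem isPreconnected_compl_closedBall (a : ℂ) {r : ℝ} (hr : 0 < r) :
    IsPreconnected (closedBall a r)ᶜ := by
  have hs : IsPreconnected (sphere (0 : ℂ) 1) :=
    isPreconnected_sphere (by simp) 0 1
  have heq : (closedBall a r)ᶜ = (fun q : ℝ × ℂ => a + q.1 • q.2) '' (Ioi r ×ˢ sphere 0 1) := by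
    ext z
    constructor
    · intro hz
      have h1 : r < ‖z - a‖ := by simpa [dist_eq_norm] using hz
      have h2 : ‖z - a‖ ≠ 0 := (hr.trans h1).ne'
      refine ⟨(‖z - a‖, ‖z - a‖⁻¹ • (z - a)), ⟨h1, ?_⟩, ?_⟩
      · simp [h2]
      · simp only [smul_smul, mul_inv_cancel₀ h2, one_smul, add_sub_cancel]
    · rintro ⟨⟨t, u⟩, ⟨ht, hu⟩, rfl⟩
      simp only [mem_Ioi, mem_sphere_zero_iff_norm] at ht hu
      simp [dist_eq_norm, hu, abs_of_pos (hr.trans ht), ht]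
  rw [heq]
  exact (isPreconnected_Ioi.prod hs).image _ (by fun_prop)

theorem hasLogOn_div_of_norm_sub_lt {s : Set ℂ} {x y : ℂ}
    (h : ∀ z ∈ s, ‖x - y‖ < ‖z - y‖) : HasLogOn (fun z => (z - x) / (z - y)) s := by
  have hne : ∀ z ∈ s, z - y ≠ 0 := fun z hz h0 => by
    have := h z hz
    rw [h0, norm_zero] at this
    exact absurd this (not_lt.2 (norm_nonneg _))
  refine HasLogOn.of_norm_sub_one_lt (ContinuousOn.div (by fun_prop) (by fun_prop) hne)
    fun z hz => ?_
  rw [div_sub_one (hne z hz), norm_div, div_lt_one (norm_pos_iff.2 (hne z hz)),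
    show z - x - (z - y) = -(x - y) by ring, norm_neg]
  exact h z hz

theorem HasLogOn.div_trans {s : Set ℂ} {x y w : ℂ} (hy : y ∉ s)
    (h₁ : HasLogOn (fun z => (z - x) / (z - y)) s)
    (h₂ : HasLogOn (fun z => (z - y) / (z - w)) s) :
    HasLogOn (fun z => (z - x) / (z - w)) s :=
  (h₁.mul h₂).congr fun z hz => by
    have : z - y ≠ 0 := sub_ne_zero.2 fun h => hy (h ▸ hz)
    simp only
    rw [div_mul_div_cancel₀ this]

theorem HasLogOn.div_symm {s : Set ℂ} {x y : ℂ}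
    (h : HasLogOn (fun z => (z - x) / (z - y)) s) : HasLogOn (fun z => (z - y) / (z - x)) s :=
  h.inv.congr fun z _ => by simp

/-- Points of a connected set disjoint from the closed set `K` are not separated by `K`, in the
sense of Eilenberg's logarithm criterion. -/
theorem hasLogOn_div_of_isPreconnected {K S : Set ℂ} (hK : IsClosed K) (hS : IsPreconnected S)
    (hSK : S ⊆ Kᶜ) {x y : ℂ} (hx : x ∈ S) (hy : y ∈ S) :
    HasLogOn (fun z => (z - x) / (z - y)) K := by
  refine hS.induction₂' (fun x y => HasLogOn (fun z => (z - x) / (z - y)) K) (fun x hx => ?_)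
    (fun x y w _ hy _ h₁ h₂ => h₁.div_trans (hSK hy) h₂) hx hy
  obtain ⟨ε, hε, hεK⟩ := Metric.isOpen_iff.1 hK.isOpen_compl x (hSK hx)
  refine nhdsWithin_le_nhds (Filter.mem_of_superset (ball_mem_nhds x hε) fun y hy => ?_)
  have h1 : HasLogOn (fun z => (z - y) / (z - x)) K := by
    refine hasLogOn_div_of_norm_sub_lt fun z hz => ?_
    have h2 : ε ≤ ‖z - x‖ := by
      rw [← dist_eq_norm]
      exact not_lt.1 fun h => hεK h hz
    rw [mem_ball, dist_eq_norm] at hy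
    linarith
  exact ⟨h1.div_symm, h1⟩

/-- If `(z - x) / (z - y)` has a continuous logarithm on the closed set `K`, then `K` does not
separate `x` from a bounded complementary component containing `y`. -/
theorem mem_of_hasLogOn_div {K S : Set ℂ} (hK : IsClosed K) (hSo : IsOpen S)
    (hSb : Bornology.IsBounded S) (hSK : frontier S ⊆ K) {x y : ℂ} (hxK : x ∉ K)
    (hyS : y ∈ S) (h : HasLogOn (fun z => (z - x) / (z - y)) K) : x ∈ S := by
  classical
  by_contra hxS
  obtain ⟨g, hg, hgf⟩ := h
  obtain ⟨G, hG⟩ := ContinuousMap.exists_restrict_eq hK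
    (⟨K.domRestrict g, hg.domRestrict⟩ : C(K, ℂ))
  have hGg : ∀ z ∈ K, G z = g z := fun z hz => DFunLike.congr_fun hG ⟨z, hz⟩
  set F : ℂ → ℂ := fun z => if z ∈ S then (z - x) * Complex.exp (-G z) else z - y with hF
  have hFc : Continuous F := by
    refine Continuous.if (fun z hz => ?_) (by fun_prop) (by fun_prop)
    have hzK : z ∈ K := hSK hz
    have h1 : z - x ≠ 0 := sub_ne_zero.2 fun h => hxK (h ▸ hzK)
    have h2 : z - y ≠ 0 := sub_ne_zero.2 fun h =>
      hSo.inter_frontier_eq.subset (show z ∈ S ∩ frontier S from ⟨h ▸ hyS, hz⟩)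
    rw [Complex.exp_neg, hGg z hzK, hgf z hzK]
    field_simp
  have hF0 : ∀ z, F z ≠ 0 := by
    intro z
    simp only [hF]
    split_ifs with hz
    · exact mul_ne_zero (sub_ne_zero.2 fun h => hxS (h ▸ hz)) (Complex.exp_ne_zero _)
    · exact sub_ne_zero.2 fun h => hz (h ▸ hyS)
  obtain ⟨r, hr, hSr⟩ := hSb.subset_ball_lt 0 y
  obtain ⟨z, -, hz⟩ := exists_zero_of_norm_sub_lt (a := y) hr hFc.continuousOn fun z hz => by
    have hzS : z ∉ S := fun h => (mem_ball.1 (hSr h)).ne hz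
    simpa [hF, hzS] using hr
  exact hF0 z hz

theorem IsPathConnected.exists_isCompact_isPreconnected {X : Type*} [TopologicalSpace X]
    {S : Set X} (hS : IsPathConnected S) {T : Set X} (hT : T.Finite) (hTS : T ⊆ S) :
    ∃ C ⊆ S, IsCompact C ∧ IsPreconnected C ∧ T ⊆ C := by
  obtain ⟨b, hb, hbS⟩ := hS
  have key : ∀ t : T, ∃ C ⊆ S, IsCompact C ∧ IsPreconnected C ∧ b ∈ C ∧ (t : X) ∈ C := fun t =>
    ⟨range (hbS (hTS t.2)).somePath, range_subset_iff.2 (hbS (hTS t.2)).somePath_mem,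
      isCompact_range (Path.continuous _), isPreconnected_range (Path.continuous _),
      ⟨0, Path.source _⟩, ⟨1, Path.target _⟩⟩
  choose C hCS hC hCp hCb hCt using key
  have := hT.to_subtype
  exact ⟨⋃ t, C t, iUnion_subset hCS, isCompact_iUnion hC,
    isPreconnected_iUnion ⟨b, mem_iInter.2 hCb⟩ hCp, fun t ht => mem_iUnion.2 ⟨⟨t, ht⟩, hCt _⟩⟩

section Gluing

variable {ι : Type*} [Finite ι] {V : ι → Set ℂ} {f : ℂ → ℂ} {h : ι → ℂ → ℂ}

theorem exists_shift_of_finite {p : ℂ} (hh : ∀ i, ContinuousOn (h i) (V i))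
    (hf : ∀ i, ∀ z ∈ V i, Complex.exp (h i z) = f z)
    (hpath : ∀ i, IsPathConnected (V i \ {p}))
    (hlog : ∀ ε > 0, HasLogOn f ((⋃ i, V i) \ ball p ε)) {T : Set ℂ} (hT : T.Finite)
    (hpT : p ∉ T) :
    ∃ c : ι → ℤ, ∀ i j, ∀ z ∈ T, z ∈ V i → z ∈ V j →
      h i z + c i * (2 * Real.pi * Complex.I) = h j z + c j * (2 * Real.pi * Complex.I) := by
  choose C hCV hC hCp hTC using fun i => (hpath i).exists_isCompact_isPreconnected
    (T := T ∩ V i) (hT.subset inter_subset_left)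
    fun z hz => ⟨hz.2, fun hzp => hpT (hzp ▸ hz.1)⟩
  have hpC : p ∈ (⋃ i, C i)ᶜ := by
    simp only [mem_compl_iff, mem_iUnion, not_exists]
    exact fun i hi => (hCV i hi).2 rfl
  obtain ⟨ε, hε, hεC⟩ := Metric.isOpen_iff.1 (isCompact_iUnion hC).isClosed.isOpen_compl p hpC
  obtain ⟨g, hg, hgf⟩ := hlog ε hε
  have hCg : ∀ i, C i ⊆ (⋃ i, V i) \ ball p ε := fun i z hz =>
    ⟨mem_iUnion.2 ⟨i, (hCV i hz).1⟩, fun hzp => hεC hzp (mem_iUnion.2 ⟨i, hz⟩)⟩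
  choose c hc using fun i => exists_int_of_exp_eq (hCp i) (hg.mono (hCg i))
    ((hh i).mono fun z hz => (hCV i hz).1)
    fun z hz => (hgf z (hCg i hz)).trans (hf i z (hCV i hz).1).symm
  exact ⟨c, fun i j z hz hi hj => (hc i z (hTC i ⟨hz, hi⟩)).symm.trans (hc j z (hTC j ⟨hz, hj⟩))⟩

theorem exists_shift {p : ℂ} (hh : ∀ i, ContinuousOn (h i) (V i))
    (hf : ∀ i, ∀ z ∈ V i, Complex.exp (h i z) = f z)
    (hpath : ∀ i, IsPathConnected (V i \ {p}))
    (hlog : ∀ ε > 0, HasLogOn f ((⋃ i, V i) \ ball p ε)) :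
    ∃ c : ι → ℤ, ∀ i j, ∀ z ≠ p, z ∈ V i → z ∈ V j →
      h i z + c i * (2 * Real.pi * Complex.I) = h j z + c j * (2 * Real.pi * Complex.I) := by
  classical
  let A : ι × ι → Set ℂ := fun q => (V q.1 ∩ V q.2) \ {p}
  have hsel : ∀ q, ∃ T : Set ℂ, T.Finite ∧ p ∉ T ∧ ((A q).Nonempty → (T ∩ A q).Nonempty) := by
    intro q
    rcases (A q).eq_empty_or_nonempty with he | ⟨z, hz⟩
    · exact ⟨∅, finite_empty, id, fun h => by simp [he] at h⟩
    · exact ⟨{z}, finite_singleton z, fun h => hz.2 h.symm, fun _ => ⟨z, rfl, hz⟩⟩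
  choose T hTfin hpT hTA using hsel
  have hT₀ : (⋃ q, T q).Finite := finite_iUnion hTfin
  have hpT₀ : p ∉ ⋃ q, T q := by simpa using fun a b => hpT (a, b)
  obtain ⟨c, hc⟩ := exists_shift_of_finite hh hf hpath hlog hT₀ hpT₀
  refine ⟨c, fun i j z hzp hi hj => ?_⟩
  obtain ⟨c', hc'⟩ := exists_shift_of_finite hh hf hpath hlog (hT₀.insert z)
    (by rw [mem_insert_iff, not_or]; exact ⟨hzp.symm, hpT₀⟩)
  obtain ⟨y, hyT, ⟨hyi, hyj⟩, -⟩ := hTA (i, j) ⟨z, ⟨hi, hj⟩, hzp⟩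
  have hy : y ∈ ⋃ q, T q := mem_iUnion.2 ⟨_, hyT⟩
  linear_combination hc' i j z (mem_insert _ _) hi hj + hc i j y hy hyi hyj
    - hc' i j y (mem_insert_of_mem _ hy) hyi hyj

/-- Logarithms of `f` on the complements of arbitrarily small neighbourhoods of two distinct
points glue to a logarithm on the whole union. -/
theorem hasLogOn_iUnion {p q : ℂ} (hpq : p ≠ q) (hV : ∀ i, IsTopologicalDisk (V i))
    (hconn : IsPreconnected (⋃ i, interior (V i)))
    (hfc : ContinuousOn f (⋃ i, V i)) (hf0 : ∀ z ∈ ⋃ i, V i, f z ≠ 0)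
    (hp : ∀ i, p ∉ interior (V i)) (hq : ∀ i, q ∉ interior (V i))
    (hlogp : ∀ ε > 0, HasLogOn f ((⋃ i, V i) \ ball p ε))
    (hlogq : ∀ ε > 0, HasLogOn f ((⋃ i, V i) \ ball q ε)) : HasLogOn f (⋃ i, V i) := by
  classical
  choose h hh hhf using fun i => (hV i).hasLogOn (hfc.mono (subset_iUnion V i))
    fun z hz => hf0 z (mem_iUnion.2 ⟨i, hz⟩)
  obtain ⟨c, hc⟩ :=
    exists_shift hh hhf (fun i => (hV i).isPathConnected_diff_singleton (hp i)) hlogp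
  obtain ⟨d, hd⟩ :=
    exists_shift hh hhf (fun i => (hV i).isPathConnected_diff_singleton (hq i)) hlogq
  have hcd : ∀ i j, ∀ z ∈ interior (V i), z ∈ interior (V j) → c i - d i = c j - d j := by
    intro i j z hi hj
    have h1 := hc i j z (fun h => hp i (h ▸ hi)) (interior_subset hi) (interior_subset hj)
    have h2 := hd i j z (fun h => hq i (h ▸ hi)) (interior_subset hi) (interior_subset hj)
    have h3 : ((c i - d i : ℤ) : ℂ) * (2 * Real.pi * Complex.I)
        = ((c j - d j : ℤ) : ℂ) * (2 * Real.pi * Complex.I) := by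
      push_cast
      linear_combination h1 - h2
    exact_mod_cast mul_right_cancel₀ Complex.two_pi_I_ne_zero h3
  have hconst : ∀ i j, c i - d i = c j - d j := by
    intro i j
    set A := ⋃ k ∈ {k | c k - d k = c i - d i}, interior (V k) with hA
    set B := ⋃ k ∈ {k | c k - d k ≠ c i - d i}, interior (V k) with hB
    by_contra hij
    obtain ⟨x, hx⟩ := (hV i).interior_nonempty
    obtain ⟨y, hy⟩ := (hV j).interior_nonempty
    have hxA : x ∈ A := mem_biUnion (show i ∈ {k | c k - d k = c i - d i} from rfl) hx
    have hyB : y ∈ B := mem_biUnion (show j ∈ {k | c k - d k ≠ c i - d i} from Ne.symm hij) hy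
    obtain ⟨z, -, hzA, hzB⟩ := hconn A B (isOpen_biUnion fun _ _ => isOpen_interior)
      (isOpen_biUnion fun _ _ => isOpen_interior)
      (iUnion_subset fun k => by
        by_cases hk : c k - d k = c i - d i
        · exact fun z hz => Or.inl (mem_biUnion (show k ∈ {k | c k - d k = c i - d i} from hk) hz)
        · exact fun z hz => Or.inr (mem_biUnion (show k ∈ {k | c k - d k ≠ c i - d i} from hk) hz))
      ⟨x, mem_iUnion.2 ⟨i, hx⟩, hxA⟩ ⟨y, mem_iUnion.2 ⟨j, hy⟩, hyB⟩
    simp only [hA, hB, mem_iUnion] at hzA hzB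
    obtain ⟨k, hk, hzk⟩ := hzA
    obtain ⟨l, hl, hzl⟩ := hzB
    exact hl ((hcd l k z hzl hzk).trans hk)
  have hcomp : ∀ i j, ∀ z, z ∈ V i → z ∈ V j →
      h i z + c i * (2 * Real.pi * Complex.I) = h j z + c j * (2 * Real.pi * Complex.I) := by
    intro i j z hi hj
    rcases ne_or_eq z p with hzp | rfl
    · exact hc i j z hzp hi hj
    · have h1 : ((c i - d i : ℤ) : ℂ) = ((c j - d j : ℤ) : ℂ) := by rw [hconst i j]
      push_cast at h1
      linear_combination hd i j z hpq hi hj + (2 * Real.pi * Complex.I) * h1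
  set g : ℂ → ℂ := fun z => if hz : ∃ i, z ∈ V i then
    h hz.choose z + c hz.choose * (2 * Real.pi * Complex.I) else 0 with hg
  have hgi : ∀ i, ∀ z ∈ V i, g z = h i z + c i * (2 * Real.pi * Complex.I) := by
    intro i z hz
    have hex : ∃ i, z ∈ V i := ⟨i, hz⟩
    simp only [hg, dif_pos hex]
    exact hcomp _ _ z hex.choose_spec hz
  refine ⟨g, (locallyFinite_of_finite V).continuousOn_iUnion (fun i => (hV i).isCompact.isClosed)
    fun i => ((hh i).add continuousOn_const).congr (hgi i), fun z hz => ?_⟩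
  obtain ⟨i, hi⟩ := mem_iUnion.1 hz
  rw [hgi i z hi, Complex.exp_add, Complex.exp_int_mul_two_pi_mul_I, mul_one, hhf i z hi]

end Gluing

theorem hasLogOn_div_diff_ball {K W W' : Set ℂ} (hK : IsClosed K) (hW : IsPreconnected W)
    (hW' : IsPreconnected W') (hWK : W ⊆ Kᶜ) (hWK' : W' ⊆ Kᶜ) {w w' p : ℂ} (hw : w ∈ W)
    (hw' : w' ∈ W') (hp : p ∈ closure W) (hp' : p ∈ closure W') {ε : ℝ} (hε : 0 < ε) :
    HasLogOn (fun z => (z - w) / (z - w')) (K \ ball p ε) := by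
  obtain ⟨u, hu, hup⟩ := Metric.mem_closure_iff.1 hp (ε / 4) (by positivity)
  obtain ⟨u', hu', hup'⟩ := Metric.mem_closure_iff.1 hp' (ε / 4) (by positivity)
  have h1 := (hasLogOn_div_of_isPreconnected hK hW hWK hw hu).mono (sdiff_subset (t := ball p ε))
  have h2 := (hasLogOn_div_of_isPreconnected hK hW' hWK' hu' hw').mono
    (sdiff_subset (t := ball p ε))
  have h3 : HasLogOn (fun z => (z - u) / (z - u')) (K \ ball p ε) := by
    refine hasLogOn_div_of_norm_sub_lt fun z hz => ?_
    have h4 : ε ≤ dist z p := not_lt.1 hz.2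
    rw [← dist_eq_norm, ← dist_eq_norm]
    have h5 := dist_triangle z u' p
    have h6 := dist_triangle u p u'
    rw [dist_comm u' p] at h5
    rw [dist_comm u p] at h6
    linarith
  exact (h1.div_trans (fun h => hWK hu h.1) h3).div_trans (fun h => hWK' hu' h.1) h2

theorem isBounded_connectedComponentIn_compl {K : Set ℂ} (hK : IsCompact K) {x y : ℂ}
    (hx : ¬ Bornology.IsBounded (connectedComponentIn Kᶜ x))
    (hne : connectedComponentIn Kᶜ y ≠ connectedComponentIn Kᶜ x) :
    Bornology.IsBounded (connectedComponentIn Kᶜ y) := by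
  obtain ⟨r, hr, hKr⟩ := hK.isBounded.subset_closedBall_lt 0 0
  have hfar : ∀ z, ¬ Bornology.IsBounded (connectedComponentIn Kᶜ z) →
      (closedBall 0 r)ᶜ ⊆ connectedComponentIn Kᶜ z := by
    intro z hz
    obtain ⟨u, hu, hur⟩ := not_subset.1 fun h => hz (isBounded_closedBall.subset h)
    rw [connectedComponentIn_eq hu]
    exact (isPreconnected_compl_closedBall 0 hr).subset_connectedComponentIn hur
      (compl_subset_compl.2 hKr)
  by_contra hy
  have hmem : ((r + 1 : ℝ) : ℂ) ∈ (closedBall (0 : ℂ) r)ᶜ := by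
    rw [mem_compl_iff, mem_closedBall_zero_iff, Complex.norm_real,
      Real.norm_of_nonneg (by linarith)]
    linarith
  exact hne ((connectedComponentIn_eq (hfar y hy hmem)).trans
    (connectedComponentIn_eq (hfar x hx hmem)).symm)

theorem frontier_inter_frontier_subsingleton {ι : Type*} [Finite ι] {V : ι → Set ℂ}
    (hV : ∀ i, IsTopologicalDisk (V i)) (hconn : IsPreconnected (⋃ i, interior (V i)))
    {x y : ℂ} (hx : x ∈ (⋃ i, V i)ᶜ) (hy : y ∈ (⋃ i, V i)ᶜ)
    (hunb : ¬ Bornology.IsBounded (connectedComponentIn (⋃ i, V i)ᶜ x))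
    (hne : connectedComponentIn (⋃ i, V i)ᶜ y ≠ connectedComponentIn (⋃ i, V i)ᶜ x) :
    (frontier (connectedComponentIn (⋃ i, V i)ᶜ y) ∩
      frontier (connectedComponentIn (⋃ i, V i)ᶜ x)).Subsingleton := by
  rintro p ⟨hpy, hpx⟩ q ⟨hqy, hqx⟩
  by_contra hpq
  set K := ⋃ i, V i with hKdef
  have hK : IsCompact K := isCompact_iUnion fun i => (hV i).isCompact
  have hint : ∀ p ∈ closure (connectedComponentIn Kᶜ x), ∀ i, p ∉ interior (V i) := by
    intro p hp i hpi
    obtain ⟨z, hzi, hzx⟩ := mem_closure_iff.1 hp _ isOpen_interior hpi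
    exact connectedComponentIn_subset _ _ hzx (mem_iUnion.2 ⟨i, interior_subset hzi⟩)
  have hlog : ∀ p, p ∈ closure (connectedComponentIn Kᶜ x) →
      p ∈ closure (connectedComponentIn Kᶜ y) → ∀ ε > 0,
      HasLogOn (fun z => (z - x) / (z - y)) (K \ ball p ε) := fun p h₁ h₂ ε hε =>
    hasLogOn_div_diff_ball hK.isClosed isPreconnected_connectedComponentIn
      isPreconnected_connectedComponentIn (connectedComponentIn_subset _ _)
      (connectedComponentIn_subset _ _) (mem_connectedComponentIn hx)
      (mem_connectedComponentIn hy) h₁ h₂ hε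
  have hsub : ∀ {a z : ℂ}, a ∈ Kᶜ → z ∈ K → z - a ≠ 0 := fun ha hz =>
    sub_ne_zero.2 fun h => ha (h ▸ hz)
  have hall : HasLogOn (fun z => (z - x) / (z - y)) K :=
    hasLogOn_iUnion hpq hV hconn (ContinuousOn.div (by fun_prop) (by fun_prop) fun z => hsub hy)
      (fun z hz => div_ne_zero (hsub hx hz) (hsub hy hz)) (hint p hpx.1) (hint q hqx.1)
      (hlog p hpx.1 hpy.1) (hlog q hqx.1 hqy.1)
  exact hne (connectedComponentIn_eq (mem_of_hasLogOn_div hK.isClosed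
    hK.isClosed.isOpen_compl.connectedComponentIn
    (isBounded_connectedComponentIn_compl hK hunb hne)
    (frontier_connectedComponentIn_compl_subset hK.isClosed y) hx (mem_connectedComponentIn hy) hall))

theorem IsTopologicalDisk.image_homeomorph {V : Set Plane} (hV : IsClosed V)
    (e : Plane ≃ₗᵢ[ℝ] ℂ) (h : V ≃ₜ closedBall (0 : Plane) 1) : IsTopologicalDisk (e '' V) := by
  have himage : e '' closedBall (0 : Plane) 1 = closedBall 0 1 := by
    rw [e.image_closedBall, map_zero]
  exact .of_homeomorph (e.toHomeomorph.isClosed_image.2 hV) <|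
    (e.toHomeomorph.image V).symm.trans <| h.trans <|
      (e.toHomeomorph.image _).trans <| Homeomorph.setCongr himage

theorem stmt_10 (n : ℕ) (V : Fin n → Set Plane)
    (hclosed : ∀ i, IsClosed (V i))
    (hdisk : ∀ i, Nonempty ((V i) ≃ₜ (closedBall (0 : Plane) 1)))
    (hconn : IsConnected (⋃ i, interior (V i)))
    (W W' : Set Plane)
    (hWcomp : ∃ x ∈ (⋃ i, V i)ᶜ, W = connectedComponentIn (⋃ i, V i)ᶜ x)
    (hWunbounded : ¬ Bornology.IsBounded W)
    (hW'comp : ∃ x ∈ (⋃ i, V i)ᶜ, W' = connectedComponentIn (⋃ i, V i)ᶜ x)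
    (hW'ne : W' ≠ W) :
    ∃ a b : Plane, frontier W' ∩ frontier W ⊆ {a, b} := by
  obtain ⟨x, hx, rfl⟩ := hWcomp
  obtain ⟨y, hy, rfl⟩ := hW'comp
  let e : Plane ≃ₗᵢ[ℝ] ℂ := Complex.orthonormalBasisOneI.repr.symm
  have hK : e '' (⋃ i, V i)ᶜ = (⋃ i, e '' V i)ᶜ := by
    rw [image_compl_eq e.bijective, image_iUnion]
  have hcomp : ∀ z ∈ (⋃ i, V i)ᶜ, e '' connectedComponentIn (⋃ i, V i)ᶜ z =
      connectedComponentIn (⋃ i, e '' V i)ᶜ (e z) := fun z hz => by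
    rw [← hK]
    exact e.toHomeomorph.image_connectedComponentIn hz
  have hfrontier : ∀ z ∈ (⋃ i, V i)ᶜ, e '' frontier (connectedComponentIn (⋃ i, V i)ᶜ z) =
      frontier (connectedComponentIn (⋃ i, e '' V i)ᶜ (e z)) := fun z hz => by
    rw [← hcomp z hz]
    exact e.toHomeomorph.image_frontier _
  have hint : ⋃ i, interior (e '' V i) = e '' ⋃ i, interior (V i) := by
    rw [image_iUnion]
    exact iUnion_congr fun i => (e.toHomeomorph.image_interior (V i)).symm
  have hsub := frontier_inter_frontier_subsingleton
    (fun i => IsTopologicalDisk.image_homeomorph (hclosed i) e (hdisk i).some)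
    (hint ▸ hconn.isPreconnected.image e e.continuous.continuousOn)
    (hK ▸ mem_image_of_mem e hx) (hK ▸ mem_image_of_mem e hy)
    (fun hb => hWunbounded <| by
      rw [← hcomp x hx] at hb
      exact (e.isometry.antilipschitz.isBounded_preimage hb).subset (subset_preimage_image _ _))
    (fun h => hW'ne <| e.injective.image_injective <| by
      simpa only [hcomp x hx, hcomp y hy] using h)
  rw [← hfrontier x hx, ← hfrontier y hy, ← image_inter e.injective] at hsub
  rcases (subsingleton_of_image e.injective _ hsub).eq_empty_or_singleton with h | ⟨a, h⟩
  · exact ⟨0, 0, h ▸ empty_subset _⟩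
  · exact ⟨a, a, h ▸ by simp⟩
end
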